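/- arXiv:1902.05903 — 2 statements merged into one kernel-verified Lean document; each statement's English description precedes it below -/
import Mathlib

section
/- For all fixed integers r ≥ 3 and t ≥ 5, one has ex_r(n, 𝓑_t) = Ω(n^{t/(t-1)} (log n)^{1/(t-1)}); that is, there exist a constant c > 0 and an integer N such that for every n ≥ N there exists an r-graph on vertex set [n] with at least c · n^{t/(t-1)} · (log n)^{1/(t-1)} edges which contains no Berge cycle of length s for any 2 ≤ s ≤ t. -/
/-- `H` has a Berge `s`-cycle: `s` distinct vertices `v 0, …, v (s-1)` and `s` distinct edges
`A 0, …, A (s-1)` of `H` with `v (i-1), v i ∈ A i` for `1 ≤ i < s`, and `v 0, v (s-1) ∈ A 0`. -/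
def HasBergeCycle {α : Type*} (H : Finset (Finset α)) (s : ℕ) : Prop :=
  ∃ (v : ℕ → α) (A : ℕ → Finset α),
    (∀ i < s, ∀ j < s, i ≠ j → v i ≠ v j) ∧
    (∀ i < s, ∀ j < s, i ≠ j → A i ≠ A j) ∧
    (∀ i < s, A i ∈ H) ∧
    (∀ i, 1 ≤ i → i < s → v (i - 1) ∈ A i ∧ v i ∈ A i) ∧
    v 0 ∈ A 0 ∧ v (s - 1) ∈ A 0

namespace BG

open Finset

/-- Vertex/edge sequences forming a Berge cycle of length `s`. -/
structure IsBC {α : Type*} (s : ℕ) (v : ℕ → α) (A : ℕ → Finset α) : Prop where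
  vinj : ∀ i < s, ∀ j < s, i ≠ j → v i ≠ v j
  ainj : ∀ i < s, ∀ j < s, i ≠ j → A i ≠ A j
  mem : ∀ i, 1 ≤ i → i < s → v (i - 1) ∈ A i ∧ v i ∈ A i
  m0 : v 0 ∈ A 0
  ml : v (s - 1) ∈ A 0

/-- The edge set of a Berge cycle of length `s`. -/
def IsCyc {α : Type*} [DecidableEq α] (C : Finset (Finset α)) (s : ℕ) : Prop :=
  ∃ (v : ℕ → α) (A : ℕ → Finset α), IsBC s v A ∧ C = (range s).image A

lemma hasBC_iff {α : Type*} [DecidableEq α] (H : Finset (Finset α)) (s : ℕ) :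
    HasBergeCycle H s ↔ ∃ C ⊆ H, IsCyc C s := by
  constructor
  · rintro ⟨v, A, h1, h2, h3, h4, h5, h6⟩
    refine ⟨(range s).image A, ?_, v, A, ⟨h1, h2, h4, h5, h6⟩, rfl⟩
    intro x hx
    simp only [mem_image, mem_range] at hx
    obtain ⟨i, hi, rfl⟩ := hx
    exact h3 i hi
  · rintro ⟨C, hC, v, A, h, rfl⟩
    refine ⟨v, A, h.vinj, h.ainj, ?_, h.mem, h.m0, h.ml⟩
    intro i hi
    exact hC (mem_image_of_mem _ (mem_range.2 hi))

lemma IsCyc.card {α : Type*} [DecidableEq α] {C : Finset (Finset α)} {s : ℕ} (h : IsCyc C s) :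
    C.card = s := by
  obtain ⟨v, A, h, rfl⟩ := h
  rw [card_image_of_injOn, card_range]
  intro i hi j hj hij
  by_contra hne
  exact h.ainj i (by simpa using hi) j (by simpa using hj) hne hij

lemma IsBC.rot {α : Type*} [DecidableEq α] {s : ℕ} {v : ℕ → α} {A : ℕ → Finset α}
    (h : IsBC s v A) {k : ℕ} (hk : k < s) :
    ∃ v' A', IsBC s v' A' ∧ A' 0 = A k ∧ (range s).image A' = (range s).image A := by
  have hs : 0 < s := by omega
  have inj : ∀ i < s, ∀ j < s, i ≠ j → (i + k) % s ≠ (j + k) % s := by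
    intro i hi j hj hij he
    apply hij
    have : i ≡ j [MOD s] := Nat.ModEq.add_right_cancel' k he
    rwa [Nat.ModEq, Nat.mod_eq_of_lt hi, Nat.mod_eq_of_lt hj] at this
  have key : ∀ j, v ((j + s - 1) % s) ∈ A (j % s) ∧ v (j % s) ∈ A (j % s) := by
    intro j
    have hj : j % s < s := Nat.mod_lt _ hs
    have e : (j + s - 1) % s = (j % s + s - 1) % s := by
      have : j + s - 1 = (j % s + s - 1) + s * (j / s) := by
        have := Nat.mod_add_div j s
        omega
      rw [this, Nat.add_mul_mod_self_left]
    rw [e]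
    rcases Nat.eq_zero_or_pos (j % s) with h0 | h0
    · rw [h0, Nat.zero_add, Nat.mod_eq_of_lt (by omega)]
      exact ⟨h.ml, h.m0⟩
    · have : (j % s + s - 1) % s = j % s - 1 := by
        have : j % s + s - 1 = (j % s - 1) + s := by omega
        rw [this, Nat.add_mod_right, Nat.mod_eq_of_lt (by omega)]
      rw [this]
      exact h.mem _ h0 hj
  refine ⟨fun i => v ((i + k) % s), fun i => A ((i + k) % s), ⟨?_, ?_, ?_, ?_, ?_⟩, ?_, ?_⟩
  · intro i hi j hj hij
    exact h.vinj _ (Nat.mod_lt _ hs) _ (Nat.mod_lt _ hs) (inj i hi j hj hij)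
  · intro i hi j hj hij
    exact h.ainj _ (Nat.mod_lt _ hs) _ (Nat.mod_lt _ hs) (inj i hi j hj hij)
  · intro i h1 hi
    refine ⟨?_, (key (i + k)).2⟩
    have := (key (i + k)).1
    have e : (i + k + s - 1) % s = (i - 1 + k) % s := by
      have : i + k + s - 1 = (i - 1 + k) + s := by omega
      rw [this, Nat.add_mod_right]
    rwa [e] at this
  · exact (key (0 + k)).2
  · have := (key (0 + k)).1
    have e : 0 + k + s - 1 = s - 1 + k := by omega
    rwa [e] at this
  · simp [Nat.mod_eq_of_lt hk]
  · apply eq_of_subset_of_card_le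
    · intro x hx
      simp only [mem_image, mem_range] at hx ⊢
      obtain ⟨i, hi, rfl⟩ := hx
      exact ⟨_, Nat.mod_lt _ hs, rfl⟩
    · rw [card_image_of_injOn, card_image_of_injOn]
      · intro i hi j hj hij
        by_contra hne
        exact h.ainj _ (Nat.mod_lt _ hs) _ (Nat.mod_lt _ hs)
          (inj i (by simpa using hi) j (by simpa using hj) hne) hij
      · intro i hi j hj hij
        by_contra hne
        exact h.ainj i (by simpa using hi) j (by simpa using hj) hne hij

lemma IsCyc.rep {α : Type*} [DecidableEq α] {C : Finset (Finset α)} {s : ℕ} (h : IsCyc C s)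
    {e : Finset α} (he : e ∈ C) :
    ∃ v A, IsBC s v A ∧ C = (range s).image A ∧ A 0 = e := by
  obtain ⟨v, A, h, rfl⟩ := h
  simp only [mem_image, mem_range] at he
  obtain ⟨k, hk, rfl⟩ := he
  obtain ⟨v', A', h1, h2, h3⟩ := h.rot hk
  exact ⟨v', A', h1, h3.symm, h2⟩

/-- The vertex set spanned by a family. -/
def U {α : Type*} [DecidableEq α] (W : Finset (Finset α)) : Finset α := W.biUnion id

lemma subset_U {α : Type*} [DecidableEq α] {W : Finset (Finset α)} {A : Finset α} (h : A ∈ W) :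
    A ⊆ U W := by
  intro x hx
  exact mem_biUnion.2 ⟨A, h, hx⟩

/-- Adding a cycle to a family meeting it, increases the excess. -/
lemma IsCyc.ext {α : Type*} [DecidableEq α] {C W : Finset (Finset α)} {s r : ℕ} (h : IsCyc C s)
    (hr : ∀ A ∈ C, A.card = r)
    {e : Finset α} (heC : e ∈ C) (heW : e ∈ W) (hn : ¬ C ⊆ W) :
    (U (W ∪ C)).card + 1 ≤ (U W).card + (r - 1) * (C \ W).card := by
  obtain ⟨v, A, hb, rfl, rfl⟩ := h.rep heC
  set I := (range s).filter (fun i => A i ∉ W) with hI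
  have hIne : I.Nonempty := by
    rw [not_subset] at hn
    obtain ⟨x, hx, hxW⟩ := hn
    simp only [mem_image, mem_range] at hx
    obtain ⟨i, hi, rfl⟩ := hx
    exact ⟨i, by simp [hI, hi, hxW]⟩
  set j := I.max' hIne with hj
  have hjI : j ∈ I := max'_mem _ _
  have hjs : j < s := by
    have := (mem_filter.1 hjI).1
    simpa using this
  have hI0 : ∀ i ∈ I, 1 ≤ i ∧ i < s ∧ A i ∉ W := by
    intro i hi
    have := mem_filter.1 hi
    refine ⟨?_, by simpa using this.1, this.2⟩
    by_contra h0
    have : i = 0 := by omega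
    subst this
    tauto
  have hvj : v j ∈ U W := by
    by_cases h1 : j = s - 1
    · rw [h1]; exact subset_U heW hb.ml
    · have hA : A (j + 1) ∈ W := by
        by_contra hA
        have : j + 1 ∈ I := by simp [hI, hA]; omega
        have := le_max' I _ this
        omega
      have := (hb.mem (j + 1) (by omega) (by omega)).1
      exact subset_U hA (by simpa using this)
  set f : ℕ → Finset α := fun i => if i = j then (A j).erase (v (j - 1)) |>.erase (v j)
    else (A i).erase (v (i - 1)) with hf
  have hin : ∀ i, i < s → v i ∈ U W ∪ I.biUnion f := by
    intro i hi
    by_cases hij : i = j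
    · rw [hij]; exact mem_union_left _ hvj
    · by_cases hiI : i ∈ I
      · refine mem_union_right _ (mem_biUnion.2 ⟨i, hiI, ?_⟩)
        have h1 := hI0 i hiI
        simp only [hf, if_neg hij, mem_erase]
        exact ⟨hb.vinj _ hi _ (by omega) (by omega), (hb.mem i h1.1 hi).2⟩
      · refine mem_union_left _ ?_
        have : A i ∈ W := by
          by_contra hA
          exact hiI (by simp [hI, hi, hA])
        rcases Nat.eq_zero_or_pos i with h0 | h0
        · subst h0; exact subset_U this hb.m0
        · exact subset_U this (hb.mem i h0 hi).2
  have hsub : U (W ∪ (range s).image A) ⊆ U W ∪ I.biUnion f := by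
    intro x hx
    simp only [U, mem_biUnion, mem_union, id] at hx
    obtain ⟨B, hB, hxB⟩ := hx
    by_cases hBW : B ∈ W
    · exact mem_union_left _ (subset_U hBW hxB)
    have hB := hB.resolve_left hBW
    simp only [mem_image, mem_range] at hB
    obtain ⟨i, hi, rfl⟩ := hB
    have hiI : i ∈ I := by simp [hI, hi, hBW]
    have h1 := hI0 i hiI
    by_cases hx1 : x = v (i - 1)
    · rw [hx1]; exact hin _ (by omega)
    by_cases hx2 : x = v i
    · rw [hx2]; exact hin _ hi
    refine mem_union_right _ (mem_biUnion.2 ⟨i, hiI, ?_⟩)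
    simp only [hf]
    split_ifs with hij
    · subst hij; simp [hx1, hx2, hxB]
    · simp [hx1, hxB]
  have hcard : ∀ i ∈ I, (f i).card + (if i = j then 1 else 0) ≤ r - 1 := by
    intro i hi
    have h1 := hI0 i hi
    have hm := hb.mem i h1.1 h1.2.1
    have hc : (A i).card = r := hr _ (mem_image_of_mem _ (mem_range.2 h1.2.1))
    have hne : v i ≠ v (i - 1) := hb.vinj _ h1.2.1 _ (by omega) (by omega)
    simp only [hf]
    split_ifs with hij
    · subst hij
      have h2 : v j ∈ (A j).erase (v (j - 1)) := mem_erase.2 ⟨hne, hm.2⟩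
      rw [card_erase_of_mem h2, card_erase_of_mem hm.1, hc]
      have : 0 < ((A j).erase (v (j - 1))).card := card_pos.2 ⟨_, h2⟩
      rw [card_erase_of_mem hm.1, hc] at this
      omega
    · rw [card_erase_of_mem hm.1, hc]
      simp
  have hsum : (∑ i ∈ I, (f i).card) + 1 ≤ (r - 1) * I.card := by
    have h1 := sum_le_sum hcard
    rw [sum_add_distrib, sum_ite_eq' I j, if_pos hjI, sum_const, smul_eq_mul] at h1
    linarith [mul_comm I.card (r - 1)]
  have hIc : I.card ≤ ((range s).image A \ W).card := by
    apply card_le_card_of_injOn A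
    · intro i hi
      have h1 := hI0 i hi
      simp only [coe_sdiff, Set.mem_sdiff, mem_coe]
      exact ⟨mem_image_of_mem _ (mem_range.2 h1.2.1), h1.2.2⟩
    · intro i hi k hk hik
      by_contra hne
      exact hb.ainj i (hI0 i hi).2.1 k (hI0 k hk).2.1 hne hik
  calc (U (W ∪ (range s).image A)).card + 1 ≤ (U W ∪ I.biUnion f).card + 1 :=
        Nat.add_le_add_right (card_le_card hsub) 1
    _ ≤ (U W).card + (∑ i ∈ I, (f i).card) + 1 := by
        have := card_union_le (U W) (I.biUnion f)
        have := card_biUnion_le (s := I) (t := f)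
        omega
    _ ≤ (U W).card + (r - 1) * I.card := by omega
    _ ≤ _ := by gcongr

/-- `e` is locally sparse in the family `K`. -/
def Nice {α : Type*} [DecidableEq α] (r t : ℕ) (K : Finset (Finset α)) (e : Finset α) : Prop :=
  ∀ W ⊆ K, e ∈ W → ∀ k, 1 ≤ k → k ≤ 3 → W.card ≤ k * (t - 1) →
    (r - 1) * W.card + 2 ≤ (U W).card + k

section nice
variable {α : Type*} [DecidableEq α] {r t : ℕ} {K : Finset (Finset α)} {e : Finset α}

lemma cyc_U_le (hr : 3 ≤ r) (hK : ∀ A ∈ K, A.card = r) {C : Finset (Finset α)}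
    {s : ℕ} (hs : 2 ≤ s) (hC : IsCyc C s) (hCK : C ⊆ K) (heC : e ∈ C) :
    (U C).card ≤ (r - 1) * s := by
  have h := hC.ext (W := {e}) (fun A hA => hK A (hCK hA)) heC (mem_singleton_self e) (by
    intro h
    have := card_le_card h
    rw [hC.card, card_singleton] at this
    omega)
  have h1 : {e} ∪ C = C := union_eq_right.2 (by simpa using heC)
  have h2 : (U {e}).card = r := by simp [U, hK e (hCK heC)]
  have h3 : (C \ {e}).card = s - 1 := by
    rw [card_sdiff_of_subset (by simpa using heC), hC.card, card_singleton]
  rw [h1, h2, h3] at h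
  obtain ⟨s, rfl⟩ : ∃ s', s = s' + 1 := ⟨s - 1, by omega⟩
  obtain ⟨r, rfl⟩ : ∃ r', r = r' + 1 := ⟨r - 1, by omega⟩
  simp only [Nat.add_sub_cancel] at h ⊢
  rw [mul_add]
  omega

lemma Nice.len (hN : Nice r t K e) (hr : 3 ≤ r) (hK : ∀ A ∈ K, A.card = r)
    {C : Finset (Finset α)}
    {s : ℕ} (hs : 2 ≤ s) (hst : s ≤ t) (hC : IsCyc C s) (hCK : C ⊆ K) (heC : e ∈ C) : s = t := by
  by_contra hne
  have h1 := cyc_U_le hr hK hs hC hCK heC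
  have h2 := hN C hCK heC 1 le_rfl (by omega) (by rw [hC.card]; omega)
  rw [hC.card] at h2
  omega

lemma excess_two (hr : 3 ≤ r) (ht : 5 ≤ t) (hK : ∀ A ∈ K, A.card = r)
    {C₁ C₂ : Finset (Finset α)} {s : ℕ} (h1 : IsCyc C₁ t) (h2 : IsCyc C₂ s) (h1K : C₁ ⊆ K)
    (h2K : C₂ ⊆ K) {f : Finset α} (hf1 : f ∈ C₁) (hf2 : f ∈ C₂) (hn : ¬ C₂ ⊆ C₁) :
    (U (C₁ ∪ C₂)).card + 1 ≤ (r - 1) * (C₁ ∪ C₂).card := by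
  have a := cyc_U_le hr hK (by omega) h1 h1K hf1
  have b := h2.ext (W := C₁) (fun A hA => hK A (h2K hA)) hf2 hf1 hn
  have c : (C₁ ∪ C₂).card = t + (C₂ \ C₁).card := by
    rw [← union_sdiff_self_eq_union, card_union_of_disjoint disjoint_sdiff, h1.card]
  rw [c, mul_add]
  omega

lemma Nice.two (hN : Nice r t K e) (hr : 3 ≤ r) (ht : 5 ≤ t) (hK : ∀ A ∈ K, A.card = r)
    {C₁ C₂ : Finset (Finset α)} {s : ℕ} (h1 : IsCyc C₁ t) (h2 : IsCyc C₂ s) (h1K : C₁ ⊆ K)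
    (h2K : C₂ ⊆ K) {f : Finset α} (he : e ∈ C₁) (hf1 : f ∈ C₁) (hf2 : f ∈ C₂) (hn : ¬ C₂ ⊆ C₁) :
    2 * t - 1 ≤ (C₁ ∪ C₂).card := by
  by_contra hlt
  have a := excess_two hr ht hK h1 h2 h1K h2K hf1 hf2 hn
  have b := hN (C₁ ∪ C₂) (union_subset h1K h2K) (mem_union_left _ he) 2 (by omega) (by omega)
    (by omega)
  omega

lemma Nice.inter (hN : Nice r t K e) (hr : 3 ≤ r) (ht : 5 ≤ t) (hK : ∀ A ∈ K, A.card = r)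
    {C₁ C₂ : Finset (Finset α)} (h1 : IsCyc C₁ t) (h2 : IsCyc C₂ t) (h1K : C₁ ⊆ K)
    (h2K : C₂ ⊆ K) (he1 : e ∈ C₁) (he2 : e ∈ C₂) (hne : C₁ ≠ C₂) {f : Finset α}
    (hf1 : f ∈ C₁) (hf2 : f ∈ C₂) : f = e := by
  have hn : ¬ C₂ ⊆ C₁ := fun h =>
    hne (eq_of_subset_of_card_le h (by rw [h1.card, h2.card])).symm
  have a := hN.two hr ht hK h1 h2 h1K h2K he1 he1 he2 hn
  have b := card_union_add_card_inter C₁ C₂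
  rw [h1.card, h2.card] at b
  have c : (C₁ ∩ C₂).card ≤ 1 := by omega
  exact card_le_one.1 c f (mem_inter.2 ⟨hf1, hf2⟩) e (mem_inter.2 ⟨he1, he2⟩)

lemma Nice.disj (hN : Nice r t K e) (hr : 3 ≤ r) (ht : 5 ≤ t) (hK : ∀ A ∈ K, A.card = r)
    {C₁ C₂ : Finset (Finset α)} (h1 : IsCyc C₁ t) (h1K : C₁ ⊆ K)
    (h2K : C₂ ⊆ K) (he1 : e ∈ C₁) (hne : C₁ ≠ C₂)
    {v : ℕ → α} {A : ℕ → Finset α} (hb : IsBC t v A) (hC2 : C₂ = (range t).image A)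
    (hA : A 0 = e) {u : Finset α} (hu : u ∈ C₁) {x : α} (hx1 : x ∈ u) (hx2 : x ∈ A 2) : False := by
  have h2 : IsCyc C₂ t := ⟨v, A, hb, hC2⟩
  have hin : ∀ i < t, A i ∈ C₂ := fun i hi => hC2 ▸ mem_image_of_mem _ (mem_range.2 hi)
  have he2 : e ∈ C₂ := hA ▸ hin 0 (by omega)
  have hno : ∀ i, 1 ≤ i → i < t → A i ∉ C₁ := by
    intro i h0 hi hmem
    have := hN.inter hr ht hK h1 h2 h1K h2K he1 he2 hne hmem (hin i hi)
    exact hb.ainj i hi 0 (by omega) (by omega) (by rw [this, hA])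
  have hU := cyc_U_le hr hK (by omega) h1 h1K he1
  have hv0 : v 0 ∈ U C₁ := subset_U he1 (hA ▸ hb.m0)
  have hx : x ∈ U C₁ := subset_U hu hx1
  have m1 := hb.mem 1 (by omega) (by omega)
  have m2 := hb.mem 2 (by omega) (by omega)
  simp only [Nat.sub_self, Nat.reduceSub] at m1 m2
  have c1 : (A 1).card = r := hK _ (h2K (hin 1 (by omega)))
  have c2 : (A 2).card = r := hK _ (h2K (hin 2 (by omega)))
  have hv01 : v 1 ≠ v 0 := hb.vinj 1 (by omega) 0 (by omega) (by omega)
  by_cases hxv : x = v 1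
  · have hsub : U (insert (A 1) C₁) ⊆ U C₁ ∪ ((A 1).erase (v 0)).erase (v 1) := by
      intro y hy
      simp only [U, biUnion_insert, id, mem_union] at hy
      rcases hy with hy | hy
      · by_cases y0 : y = v 0
        · rw [y0]; exact mem_union_left _ hv0
        by_cases y1 : y = v 1
        · rw [y1, ← hxv]; exact mem_union_left _ hx
        · exact mem_union_right _ (by simp [y0, y1, hy])
      · exact mem_union_left _ hy
    have hc := card_le_card hsub
    have hc2 := card_union_le (U C₁) (((A 1).erase (v 0)).erase (v 1))
    rw [card_erase_of_mem (mem_erase.2 ⟨hv01, m1.2⟩), card_erase_of_mem m1.1, c1] at hc2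
    have hcard : (insert (A 1) C₁).card = t + 1 := by
      rw [card_insert_of_notMem (hno 1 (by omega) (by omega)), h1.card]
    have := hN (insert (A 1) C₁) (insert_subset (h2K (hin 1 (by omega))) h1K)
      (mem_insert_of_mem he1) 2 (by omega) (by omega) (by omega)
    rw [hcard, mul_add] at this
    omega
  · have hsub : U (insert (A 2) (insert (A 1) C₁)) ⊆
        U C₁ ∪ ((A 1).erase (v 0) ∪ ((A 2).erase (v 1)).erase x) := by
      intro y hy
      simp only [U, biUnion_insert, id, mem_union] at hy
      rcases hy with hy | hy | hy
      · by_cases y0 : y = x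
        · rw [y0]; exact mem_union_left _ hx
        by_cases y1 : y = v 1
        · rw [y1]
          refine mem_union_right _ (mem_union_left _ (mem_erase.2 ⟨hv01, m1.2⟩))
        · exact mem_union_right _ (mem_union_right _ (by simp [y0, y1, hy]))
      · by_cases y0 : y = v 0
        · rw [y0]; exact mem_union_left _ hv0
        · exact mem_union_right _ (mem_union_left _ (by simp [y0, hy]))
      · exact mem_union_left _ hy
    have hc := card_le_card hsub
    have hc2 := card_union_le (U C₁) ((A 1).erase (v 0) ∪ ((A 2).erase (v 1)).erase x)
    have hc3 := card_union_le ((A 1).erase (v 0)) (((A 2).erase (v 1)).erase x)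
    rw [card_erase_of_mem (mem_erase.2 ⟨hxv, hx2⟩), card_erase_of_mem m1.1,
      card_erase_of_mem m2.1, c1, c2] at hc3
    have hcard : (insert (A 2) (insert (A 1) C₁)).card = t + 2 := by
      rw [card_insert_of_notMem, card_insert_of_notMem (hno 1 (by omega) (by omega)), h1.card]
      rw [mem_insert, not_or]
      exact ⟨hb.ainj 2 (by omega) 1 (by omega) (by omega), hno 2 (by omega) (by omega)⟩
    have := hN (insert (A 2) (insert (A 1) C₁)) (insert_subset (h2K (hin 2 (by omega)))
      (insert_subset (h2K (hin 1 (by omega))) h1K))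
      (mem_insert_of_mem (mem_insert_of_mem he1)) 2 (by omega) (by omega) (by omega)
    rw [hcard, mul_add] at this
    omega

lemma Nice.conflict (hN : Nice r t K e) (hr : 3 ≤ r) (ht : 5 ≤ t) (hK : ∀ A ∈ K, A.card = r)
    {C₁ C₂ C₃ : Finset (Finset α)} {s : ℕ} (h1 : IsCyc C₁ t) (h2 : IsCyc C₂ t) (h3 : IsCyc C₃ s)
    (hst : s ≤ t) (h1K : C₁ ⊆ K) (h2K : C₂ ⊆ K) (h3K : C₃ ⊆ K)
    (he1 : e ∈ C₁) (he2 : e ∈ C₂) (he3 : e ∉ C₃) (hne : C₁ ≠ C₂) {u₁ u₂ : Finset α}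
    (hu1 : u₁ ∈ C₁) (hu2 : u₂ ∈ C₂) (hu13 : u₁ ∈ C₃) (hu23 : u₂ ∈ C₃) : False := by
  have hu1e : u₁ ≠ e := fun h => he3 (h ▸ hu13)
  have hu2e : u₂ ≠ e := fun h => he3 (h ▸ hu23)
  have hinter : ∀ f ∈ C₁, f ∈ C₂ → f = e := fun f hf1 hf2 =>
    hN.inter hr ht hK h1 h2 h1K h2K he1 he2 hne hf1 hf2
  have hu21 : u₂ ∉ C₁ := fun h => hu2e (hinter _ h hu2)
  have hu12 : u₁ ∉ C₂ := fun h => hu1e (hinter _ hu1 h)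
  have hn : ¬ C₂ ⊆ C₁ := fun h => hu21 (h hu2)
  have hc12 : (C₁ ∪ C₂).card = 2 * t - 1 := by
    have b := card_union_add_card_inter C₁ C₂
    have : C₁ ∩ C₂ = {e} := by
      ext f
      simp only [mem_inter, mem_singleton]
      exact ⟨fun h => hinter f h.1 h.2, fun h => by subst h; exact ⟨he1, he2⟩⟩
    rw [this, h1.card, h2.card, card_singleton] at b
    omega
  by_cases hsub : C₃ ⊆ C₁ ∪ C₂
  · -- `C₁ ∪ C₃ = C₁ ∪ C₂` and `C₂ ∪ C₃ = C₁ ∪ C₂`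
    have a := hN.two hr ht hK h1 h3 h1K h3K he1 hu1 hu13 (fun h => hu21 (h hu23))
    have b := hN.two hr ht hK h2 h3 h2K h3K he2 hu2 hu23 (fun h => hu12 (h hu13))
    have a' : C₁ ∪ C₃ = C₁ ∪ C₂ := eq_of_subset_of_card_le
      (union_subset subset_union_left hsub) (by omega)
    have b' : C₂ ∪ C₃ = C₁ ∪ C₂ := eq_of_subset_of_card_le
      (union_subset subset_union_right hsub) (by omega)
    have hall : (C₁ ∪ C₂).erase e ⊆ C₃ := by
      intro f hf
      rw [mem_erase, mem_union] at hf
      obtain ⟨hfe, hf | hf⟩ := hf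
      · have : f ∈ C₂ ∪ C₃ := b' ▸ mem_union_left _ hf
        rcases mem_union.1 this with h | h
        · exact absurd (hinter f hf h) hfe
        · exact h
      · have : f ∈ C₁ ∪ C₃ := a' ▸ mem_union_right _ hf
        rcases mem_union.1 this with h | h
        · exact absurd (hinter f h hf) hfe
        · exact h
    have := card_le_card hall
    rw [card_erase_of_mem (mem_union_left _ he1), hc12, h3.card] at this
    omega
  · have a := excess_two hr ht hK h1 h2 h1K h2K he1 he2 hn
    have b := h3.ext (W := C₁ ∪ C₂) (fun A hA => hK A (h3K hA)) hu13 (mem_union_left _ hu1) hsub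
    have c : (C₁ ∪ C₂ ∪ C₃).card = (2 * t - 1) + (C₃ \ (C₁ ∪ C₂)).card := by
      rw [← union_sdiff_self_eq_union, card_union_of_disjoint disjoint_sdiff, hc12]
    have d : (C₃ \ (C₁ ∪ C₂)).card + 2 ≤ t := by
      have h4 : ({u₁, u₂} : Finset (Finset α)) ⊆ C₃ ∩ (C₁ ∪ C₂) := by
        intro f hf
        simp only [mem_insert, mem_singleton] at hf
        rcases hf with rfl | rfl
        · exact mem_inter.2 ⟨hu13, mem_union_left _ hu1⟩
        · exact mem_inter.2 ⟨hu23, mem_union_right _ hu2⟩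
      have h5 := card_le_card h4
      rw [card_pair (fun h : u₁ = u₂ => hu21 (h ▸ hu1))] at h5
      have h6 := card_sdiff_add_card_inter C₃ (C₁ ∪ C₂)
      rw [h3.card] at h6
      omega
    have := hN (C₁ ∪ C₂ ∪ C₃) (union_subset (union_subset h1K h2K) h3K)
      (mem_union_left _ (mem_union_left _ he1)) 3 (by omega) (by omega) (by omega)
    rw [c, mul_add, ← hc12] at this
    omega

end nice


lemma classCount {E : Type*} [DecidableEq E] (F G : Finset (Finset E)) (e : E) (Us : Finset E)
    (R : Finset E → Finset E) (x : ℕ) (hGF : G ⊆ F) (hGe : ∀ H ∈ G, e ∉ H) (_heU : e ∉ Us)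
    (hR : ∀ σ, R σ ⊆ Us) (hdown : ∀ H ∈ F, ∀ H' ⊆ H, H' ∈ F)
    (ha : ∀ σ T, e ∉ σ → Disjoint σ Us → T ⊆ Us → σ ∈ F → (∀ u ∈ T, insert u σ ∈ F) → σ ∪ T ∈ F)
    (hb : ∀ H ∈ G, insert e (H \ R (H \ Us)) ∈ F)
    (hc : ∀ H ∈ G, (H ∩ R (H \ Us)).card ≤ x) :
    2 * G.card ≤ F.card + 2 * (4 ^ x * (F.filter (e ∈ ·)).card) := by
  classical
  set R' : Finset E → Finset E := fun σ => (R σ).filter (fun u => insert u σ ∈ F) with hR'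
  have hR'U : ∀ σ, R' σ ⊆ Us := fun σ => (filter_subset _ _).trans (hR σ)
  have hins : ∀ H ∈ G, ∀ u ∈ H, insert u (H \ Us) ∈ F := fun H hH u hu =>
    hdown H (hGF hH) _ (insert_subset hu sdiff_subset)
  have hHR : ∀ H ∈ G, ∀ u ∈ H, (u ∈ R' (H \ Us) ↔ u ∈ R (H \ Us)) := by
    intro H hH u hu
    simp only [hR', mem_filter]
    exact ⟨fun h => h.1, fun h => ⟨h, hins H hH u hu⟩⟩
  set G1 := G.filter (fun H => 2 * x < (R' (H \ Us)).card) with hG1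
  set G2 := G.filter (fun H => ¬ 2 * x < (R' (H \ Us)).card) with hG2
  have hsplit : G1.card + G2.card = G.card := card_filter_add_card_filter_not _
  -- first part
  set Φ : Finset E → Finset E := fun H => (H \ Us) ∪ symmDiff (H ∩ Us) (R' (H \ Us)) with hΦ
  have hsd : ∀ H, symmDiff (H ∩ Us) (R' (H \ Us)) ⊆ Us := by
    intro H y hy
    rw [mem_symmDiff] at hy
    rcases hy with hy | hy
    · exact (mem_inter.1 hy.1).2
    · exact hR'U _ hy.1
  have hΦ1 : ∀ H, Φ H \ Us = H \ Us := by
    intro H; ext y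
    have := @hsd H y
    simp only [hΦ, mem_sdiff, mem_union]
    tauto
  have hΦ2 : ∀ H, Φ H ∩ Us = symmDiff (H ∩ Us) (R' (H \ Us)) := by
    intro H; ext y
    have := @hsd H y
    simp only [hΦ, mem_sdiff, mem_union, mem_inter]
    tauto
  have hΦF : ∀ H ∈ G1, Φ H ∈ F := by
    intro H hH
    have hHG : H ∈ G := (mem_filter.1 hH).1
    apply ha _ _ (fun h => hGe H hHG (mem_sdiff.1 h).1) sdiff_disjoint (hsd H)
      (hdown H (hGF hHG) _ sdiff_subset)
    intro u hu
    rw [mem_symmDiff] at hu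
    rcases hu with hu | hu
    · exact hins H hHG u (mem_inter.1 hu.1).1
    · exact (mem_filter.1 hu.1).2
  have hΦinj : Set.InjOn Φ G1 := by
    intro H _ H' _ hEq
    have e1 : H \ Us = H' \ Us := by rw [← hΦ1 H, ← hΦ1 H', hEq]
    have e2 : H ∩ Us = H' ∩ Us := by
      have : symmDiff (H ∩ Us) (R' (H \ Us)) = symmDiff (H' ∩ Us) (R' (H \ Us)) := by
        rw [← hΦ2 H, hEq, hΦ2 H', e1]
      exact symmDiff_left_injective _ this
    rw [← sdiff_union_inter H Us, e1, e2, sdiff_union_inter]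
  have hΦG : ∀ H ∈ G1, Φ H ∉ G := by
    intro H hH hmem
    obtain ⟨hHG, hlt⟩ := mem_filter.1 hH
    have h1 := hc _ hmem
    rw [hΦ1] at h1
    have h2 := hc _ hHG
    have h3 : R' (H \ Us) \ H ⊆ Φ H ∩ R (H \ Us) := by
      intro y hy
      rw [mem_sdiff] at hy
      refine mem_inter.2 ⟨mem_union_right _ (mem_symmDiff.2 (Or.inr ⟨hy.1, ?_⟩)),
        (mem_filter.1 hy.1).1⟩
      exact fun h => hy.2 (mem_inter.1 h).1
    have h4 := card_le_card h3
    have h5 : R' (H \ Us) ∩ H ⊆ H ∩ R (H \ Us) := by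
      intro y hy
      rw [mem_inter] at hy
      exact mem_inter.2 ⟨hy.2, (mem_filter.1 hy.1).1⟩
    have h6 := card_le_card h5
    have h7 := card_sdiff_add_card_inter (R' (H \ Us)) H
    omega
  have hG1F : 2 * G1.card ≤ F.card := by
    have h1 : (G1.image Φ).card = G1.card := card_image_of_injOn hΦinj
    have h2 : Disjoint G1 (G1.image Φ) := by
      rw [disjoint_left]
      intro y hy hy'
      obtain ⟨H, hH, rfl⟩ := mem_image.1 hy'
      exact hΦG H hH (mem_filter.1 hy).1
    have h3 : G1 ∪ G1.image Φ ⊆ F := by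
      apply union_subset
      · exact (filter_subset _ _).trans hGF
      · intro y hy
        obtain ⟨H, hH, rfl⟩ := mem_image.1 hy
        exact hΦF H hH
    have h4 := card_le_card h3
    rw [card_union_of_disjoint h2, h1] at h4
    omega
  -- second part
  set Ψ : Finset E → Finset E := fun H => insert e (H \ R (H \ Us)) with hΨ
  have hG2F : G2.card ≤ 4 ^ x * (F.filter (e ∈ ·)).card := by
    have h1 : ∀ K ∈ F.filter (e ∈ ·), (G2.filter (fun H => Ψ H = K)).card ≤ 4 ^ x := by
      intro K hK
      set σ := (K.erase e) \ Us with hσ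
      have hdet : ∀ H ∈ G2, Ψ H = K → H \ Us = σ := by
        intro H hH hEq
        have hHG := (mem_filter.1 hH).1
        rw [hσ, ← hEq]
        ext y
        have hy1 : y ∈ R (H \ Us) → y ∈ Us := fun h => hR _ h
        have hy2 : y ∈ H → y ≠ e := fun h h' => hGe H hHG (h' ▸ h)
        simp only [hΨ, mem_sdiff, mem_erase, mem_insert]
        tauto
      by_cases hne : (G2.filter (fun H => Ψ H = K)).Nonempty
      · have h2 : G2.filter (fun H => Ψ H = K) ⊆
            (R' σ).powerset.image (fun S => K.erase e ∪ S) := by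
          intro H hH
          obtain ⟨hH2, hEq⟩ := mem_filter.1 hH
          have hHG := (mem_filter.1 hH2).1
          have hs := hdet H hH2 hEq
          refine mem_image.2 ⟨H ∩ R' σ, mem_powerset.2 inter_subset_right, ?_⟩
          rw [← hEq]
          ext y
          have hy1 : y ∈ H → (y ∈ R' (H \ Us) ↔ y ∈ R (H \ Us)) := hHR H hHG y
          have hy2 : y ∈ H → y ≠ e := fun h h' => hGe H hHG (h' ▸ h)
          rw [hs] at hy1
          simp only [hΨ, mem_union, mem_inter, mem_erase, mem_insert, mem_sdiff, hs]
          tauto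
        have h3 := (card_le_card h2).trans card_image_le
        rw [card_powerset] at h3
        obtain ⟨H, hH⟩ := hne
        obtain ⟨hH2, hEq⟩ := mem_filter.1 hH
        have h4 := (mem_filter.1 hH2).2
        rw [hdet H hH2 hEq, not_lt] at h4
        calc _ ≤ 2 ^ (R' σ).card := h3
          _ ≤ 2 ^ (2 * x) := Nat.pow_le_pow_right (by norm_num) h4
          _ = 4 ^ x := by rw [pow_mul]; norm_num
      · rw [not_nonempty_iff_eq_empty.1 hne]; simp
    have h2 : ∀ H ∈ G2, Ψ H ∈ F.filter (e ∈ ·) := by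
      intro H hH
      exact mem_filter.2 ⟨hb H (mem_filter.1 hH).1, mem_insert_self _ _⟩
    have := card_le_mul_card_image_of_maps_to h2 (4 ^ x) h1
    linarith
  omega

/-- Walks of length `ℓ` in `H` from `x`, listed as pairs (edge, next vertex). -/
def walks {α : Type*} [DecidableEq α] (H : Finset (Finset α)) :
    ℕ → α → Finset (List (Finset α × α))
  | 0, _ => {[]}
  | ℓ + 1, x => (H.filter (x ∈ ·)).biUnion fun A => A.biUnion fun y =>
      (walks H ℓ y).image (List.cons (A, y))

/-- Endpoint of a walk. -/
def ep {α : Type*} : List (Finset α × α) → α → α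
  | [], x => x
  | p :: l, _ => ep l p.2

/-- The walk along a cycle. -/
def wl {α : Type*} (v : ℕ → α) (A : ℕ → Finset α) : ℕ → ℕ → List (Finset α × α)
  | _, 0 => []
  | k, ℓ + 1 => (A (k + 1), v (k + 1)) :: wl v A (k + 1) ℓ

lemma card_walks_le {α : Type*} [DecidableEq α] {H : Finset (Finset α)} {r Δ : ℕ}
    (hr : ∀ A ∈ H, A.card = r) (hΔ : ∀ x, (H.filter (x ∈ ·)).card ≤ Δ) (ℓ : ℕ) (x : α) :
    (walks H ℓ x).card ≤ (r * Δ) ^ ℓ := by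
  induction ℓ generalizing x with
  | zero => simp [walks]
  | succ ℓ ih =>
    rw [walks]
    calc _ ≤ ∑ A ∈ H.filter (x ∈ ·), (A.biUnion fun y =>
              (walks H ℓ y).image (List.cons (A, y))).card := card_biUnion_le
      _ ≤ ∑ A ∈ H.filter (x ∈ ·), r * (r * Δ) ^ ℓ := by
          apply sum_le_sum
          intro A hA
          calc _ ≤ ∑ y ∈ A, ((walks H ℓ y).image (List.cons (A, y))).card := card_biUnion_le
            _ ≤ ∑ y ∈ A, (r * Δ) ^ ℓ := sum_le_sum fun y _ => card_image_le.trans (ih y)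
            _ = _ := by rw [sum_const, hr A (mem_filter.1 hA).1, smul_eq_mul]
      _ = (H.filter (x ∈ ·)).card * (r * (r * Δ) ^ ℓ) := by rw [sum_const, smul_eq_mul]
      _ ≤ Δ * (r * (r * Δ) ^ ℓ) := Nat.mul_le_mul_right _ (hΔ x)
      _ = _ := by ring

lemma wl_mem {α : Type*} [DecidableEq α] {H : Finset (Finset α)} {v : ℕ → α} {A : ℕ → Finset α}
    (ℓ k : ℕ) (h : ∀ i, k < i → i ≤ k + ℓ → A i ∈ H ∧ v (i - 1) ∈ A i ∧ v i ∈ A i) :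
    wl v A k ℓ ∈ walks H ℓ (v k) ∧ ep (wl v A k ℓ) (v k) = v (k + ℓ) := by
  induction ℓ generalizing k with
  | zero => simp [wl, walks, ep]
  | succ ℓ ih =>
    have h1 := h (k + 1) (by omega) (by omega)
    have h2 := ih (k + 1) (fun i hi hi' => h i (by omega) (by omega))
    simp only [Nat.add_sub_cancel] at h1
    constructor
    · rw [wl, walks]
      refine mem_biUnion.2 ⟨A (k + 1), mem_filter.2 ⟨h1.1, h1.2.1⟩, mem_biUnion.2 ⟨v (k + 1), h1.2.2, ?_⟩⟩
      exact mem_image_of_mem _ h2.1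
    · rw [wl, ep, h2.2]
      congr 1
      omega

/-- Walks of length `ℓ` in `H` joining two different vertices of `e`. -/
def nearSet {α : Type*} [DecidableEq α] (ℓ : ℕ) (H : Finset (Finset α)) (e : Finset α) :
    Finset (Σ _ : α, List (Finset α × α)) :=
  e.sigma fun x => (walks H ℓ x).filter fun w => ep w x ∈ e ∧ ep w x ≠ x

open Classical in
/-- Admissible subfamilies. -/
noncomputable def FF {α : Type*} (t Δ : ℕ) (K : Finset (Finset α)) :
    Finset (Finset (Finset α)) :=
  K.powerset.filter fun H => (∀ s, 2 ≤ s → s ≤ t → ¬ HasBergeCycle H s) ∧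
    ∀ x, (H.filter (x ∈ ·)).card ≤ Δ

lemma mem_FF {α : Type*} [DecidableEq α] {t Δ : ℕ} {K H : Finset (Finset α)} :
    H ∈ FF t Δ K ↔ H ⊆ K ∧ (∀ s, 2 ≤ s → s ≤ t → ∀ C ⊆ H, ¬ IsCyc C s) ∧
      ∀ x, (H.filter (x ∈ ·)).card ≤ Δ := by
  classical
  simp only [FF, mem_filter, mem_powerset, hasBC_iff, not_exists, not_and]
  refine and_congr_right fun _ => and_congr_right fun _ => ?_
  refine forall_congr' fun x => ?_
  convert Iff.rfl

lemma FF_down {α : Type*} [DecidableEq α] {t Δ : ℕ} {K H H' : Finset (Finset α)}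
    (h : H ∈ FF t Δ K) (hH : H' ⊆ H) : H' ∈ FF t Δ K := by
  rw [mem_FF] at h ⊢
  refine ⟨hH.trans h.1, fun s h1 h2 C hC => h.2.1 s h1 h2 C (hC.trans hH), fun x => ?_⟩
  exact (card_le_card (filter_subset_filter _ hH)).trans (h.2.2 x)

/-- `e` is good for `H`. -/
def Good {α : Type*} [DecidableEq α] (t Δ x : ℕ) (H : Finset (Finset α)) (e : Finset α) : Prop :=
  e ∉ H ∧ (∀ y ∈ e, (H.filter (y ∈ ·)).card < Δ) ∧ (nearSet (t - 1) H e).card ≤ x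

open Classical in
lemma nice_count {α : Type*} [DecidableEq α] {r t Δ x : ℕ} {K : Finset (Finset α)} {e : Finset α}
    (hN : Nice r t K e) (hr : 3 ≤ r) (ht : 5 ≤ t) (hK : ∀ A ∈ K, A.card = r) (heK : e ∈ K) :
    2 * ((FF t Δ K).filter fun H => Good t Δ x H e).card ≤
      (FF t Δ K).card + 2 * (4 ^ x * ((FF t Δ K).filter (e ∈ ·)).card) := by
  have hex : ∀ C : Finset (Finset α), ∃ u : Finset α, IsCyc C t → e ∈ C →
      ∃ v A, IsBC t v A ∧ C = (range t).image A ∧ A 0 = e ∧ A 2 = u := by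
    intro C
    by_cases h : IsCyc C t ∧ e ∈ C
    · obtain ⟨v, A, h1, h2, h3⟩ := h.1.rep h.2
      exact ⟨A 2, fun _ _ => ⟨v, A, h1, h2, h3, rfl⟩⟩
    · exact ⟨∅, fun h1 h2 => absurd ⟨h1, h2⟩ h⟩
  choose u hu using hex
  set CY := K.powerset.filter (fun C => IsCyc C t ∧ e ∈ C) with hCY
  have hcy : ∀ C ∈ CY, C ⊆ K ∧ IsCyc C t ∧ e ∈ C := by
    intro C hC
    have := mem_filter.1 hC
    exact ⟨mem_powerset.1 this.1, this.2⟩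
  have huC : ∀ C ∈ CY, u C ∈ C ∧ u C ≠ e := by
    intro C hC
    obtain ⟨h1, h2, h3⟩ := hcy C hC
    obtain ⟨v, A, hb, hCA, h0, h2⟩ := hu C h2 h3
    rw [← h2]
    refine ⟨hCA ▸ mem_image_of_mem _ (mem_range.2 (by omega)), ?_⟩
    rw [← h0]
    exact hb.ainj 2 (by omega) 0 (by omega) (by omega)
  apply classCount (FF t Δ K) _ e (CY.image u)
    (fun σ => (CY.filter (fun C => C \ {e, u C} ⊆ σ)).image u) x
  · exact filter_subset _ _
  · intro H hH; exact (mem_filter.1 hH).2.1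
  · intro h
    obtain ⟨C, hC, hCe⟩ := mem_image.1 h
    exact (huC C hC).2 hCe
  · intro σ; exact image_subset_image (filter_subset _ _)
  · intro H hH H' hH'; exact FF_down hH hH'
  · intro σ T heσ hdis hT hσ hins
    have hTe : e ∉ T := by
      intro h
      obtain ⟨C, hC, hCe⟩ := mem_image.1 (hT h)
      exact (huC C hC).2 hCe
    have hKT : σ ∪ T ⊆ K := union_subset (mem_FF.1 hσ).1
      (fun f hf => (mem_FF.1 (hins f hf)).1 (mem_insert_self _ _))
    rw [mem_FF]
    refine ⟨hKT, ?_, ?_⟩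
    · intro s hs hst C hC hcyc
      by_cases h0 : C ⊆ σ
      · exact (mem_FF.1 hσ).2.1 s hs hst C h0 hcyc
      · rw [not_subset] at h0
        obtain ⟨f, hfC, hfσ⟩ := h0
        have hfT : f ∈ T := (mem_union.1 (hC hfC)).resolve_left hfσ
        by_cases h1 : C ⊆ insert f σ
        · exact (mem_FF.1 (hins f hfT)).2.1 s hs hst C h1 hcyc
        · rw [not_subset] at h1
          obtain ⟨g, hgC, hg⟩ := h1
          rw [mem_insert, not_or] at hg
          have hgT : g ∈ T := (mem_union.1 (hC hgC)).resolve_left hg.2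
          obtain ⟨C1, hC1, rfl⟩ := mem_image.1 (hT hfT)
          obtain ⟨C2, hC2, rfl⟩ := mem_image.1 (hT hgT)
          have hne : C1 ≠ C2 := fun h => hg.1 (by rw [h])
          obtain ⟨a1, a2, a3⟩ := hcy C1 hC1
          obtain ⟨b1, b2, b3⟩ := hcy C2 hC2
          refine hN.conflict hr ht hK a2 b2 hcyc hst a1 b1 (hC.trans hKT) a3 b3 ?_ hne
            (huC _ hC1).1 (huC _ hC2).1 hfC hgC
          intro h
          rcases mem_union.1 (hC h) with h | h
          · exact heσ h
          · exact hTe h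
    · intro y
      by_cases h0 : ∃ f ∈ T, y ∈ f
      · obtain ⟨f, hfT, hyf⟩ := h0
        refine le_trans (card_le_card ?_) ((mem_FF.1 (hins f hfT)).2.2 y)
        intro g hg
        rw [mem_filter] at hg ⊢
        refine ⟨?_, hg.2⟩
        rw [mem_insert]
        rcases mem_union.1 hg.1 with h | hgT
        · exact Or.inr h
        · left
          by_contra hne'
          obtain ⟨C1, hC1, rfl⟩ := mem_image.1 (hT hfT)
          obtain ⟨C2, hC2, rfl⟩ := mem_image.1 (hT hgT)
          have hne : C1 ≠ C2 := fun h => hne' (by rw [h])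
          obtain ⟨a1, a2, a3⟩ := hcy C1 hC1
          obtain ⟨b1, b2, b3⟩ := hcy C2 hC2
          obtain ⟨v, A, hb, hCA, h0, h2⟩ := hu C2 b2 b3
          exact hN.disj hr ht hK a2 a1 b1 a3 hne hb hCA h0 (huC _ hC1).1 hyf (h2 ▸ hg.2)
      · refine le_trans (card_le_card ?_) ((mem_FF.1 hσ).2.2 y)
        intro g hg
        rw [mem_filter] at hg ⊢
        refine ⟨?_, hg.2⟩
        rcases mem_union.1 hg.1 with h | hgT
        · exact h
        · exact absurd ⟨g, hgT, hg.2⟩ h0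
  · intro H hH
    obtain ⟨hHF, heH, hdeg, hnear⟩ := mem_filter.1 hH
    set Rr := (CY.filter (fun C => C \ {e, u C} ⊆ H \ CY.image u)).image u with hRr
    have hsubK : insert e (H \ Rr) ⊆ K :=
      insert_subset heK (sdiff_subset.trans (mem_FF.1 hHF).1)
    rw [mem_FF]
    refine ⟨hsubK, ?_, ?_⟩
    · intro s hs hst C hC hcyc
      by_cases heC : e ∈ C
      · have hCK := hC.trans hsubK
        have := hN.len hr hK hs hst hcyc hCK heC
        subst this
        have hCCY : C ∈ CY := by
          simp only [hCY, mem_filter, mem_powerset]; exact ⟨hCK, hcyc, heC⟩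
        have huR : u C ∈ Rr := by
          refine mem_image_of_mem _ (mem_filter.2 ⟨hCCY, ?_⟩)
          intro f hf
          simp only [mem_sdiff, mem_insert, mem_singleton, not_or] at hf
          obtain ⟨hfC, hfe, hfu⟩ := hf
          have hfH := (mem_insert.1 (hC hfC)).resolve_left hfe
          refine mem_sdiff.2 ⟨(mem_sdiff.1 hfH).1, ?_⟩
          intro hfU
          obtain ⟨C', hC', rfl⟩ := mem_image.1 hfU
          obtain ⟨b1, b2, b3⟩ := hcy C' hC'
          have hne : C ≠ C' := fun h => hfu (by rw [h])
          exact hfe (hN.inter hr ht hK hcyc b2 hCK b1 heC b3 hne hfC (huC _ hC').1)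
        have hu' := huC C hCCY
        have := (mem_insert.1 (hC hu'.1)).resolve_left hu'.2
        exact (mem_sdiff.1 this).2 huR
      · refine (mem_FF.1 hHF).2.1 s hs hst C ?_ hcyc
        intro f hf
        have hfe : f ≠ e := fun h => heC (h ▸ hf)
        exact (mem_sdiff.1 ((mem_insert.1 (hC hf)).resolve_left hfe)).1
    · intro y
      by_cases hy : y ∈ e
      · have h1 := hdeg y hy
        have h2 : (insert e (H \ Rr)).filter (y ∈ ·) ⊆ insert e (H.filter (y ∈ ·)) := by
          intro f hf
          simp only [mem_filter, mem_insert, mem_sdiff] at hf ⊢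
          tauto
        have h3 := (card_le_card h2).trans (card_insert_le _ _)
        omega
      · refine le_trans (card_le_card ?_) ((mem_FF.1 hHF).2.2 y)
        intro f hf
        simp only [mem_filter, mem_insert, mem_sdiff] at hf ⊢
        have : f ≠ e := by rintro rfl; exact hy hf.2
        tauto
  · intro H hH
    obtain ⟨hHF, heH, hdeg, hnear⟩ := mem_filter.1 hH
    refine le_trans ?_ hnear
    have hsub : H ∩ (CY.filter (fun C => C \ {e, u C} ⊆ H \ CY.image u)).image u ⊆
        (nearSet (t - 1) H e).image (fun p => (p.2[1]?.map Prod.fst).getD ∅) := by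
      intro f hf
      obtain ⟨hfH, hf⟩ := mem_inter.1 hf
      obtain ⟨C, hC, rfl⟩ := mem_image.1 hf
      obtain ⟨hC, hCs⟩ := mem_filter.1 hC
      obtain ⟨b1, b2, b3⟩ := hcy C hC
      obtain ⟨v, A, hb, hCA, h0, h2⟩ := hu C b2 b3
      have hAH : ∀ i, 0 < i → i ≤ 0 + (t - 1) → A i ∈ H ∧ v (i - 1) ∈ A i ∧ v i ∈ A i := by
        intro i hi hi'
        refine ⟨?_, hb.mem i hi (by omega)⟩
        by_cases hiu : A i = u C
        · rw [hiu]; exact hfH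
        · refine (mem_sdiff.1 (hCs ?_)).1
          simp only [mem_sdiff, mem_insert, mem_singleton, not_or]
          refine ⟨hCA ▸ mem_image_of_mem _ (mem_range.2 (by omega)), ?_, hiu⟩
          rw [← h0]
          exact hb.ainj i (by omega) 0 (by omega) (by omega)
      have hw := wl_mem (t - 1) 0 hAH
      refine mem_image.2 ⟨⟨v 0, wl v A 0 (t - 1)⟩, ?_, ?_⟩
      · simp only [nearSet, mem_sigma, mem_filter]
        rw [hw.2, Nat.zero_add]
        exact ⟨h0 ▸ hb.m0, hw.1, h0 ▸ hb.ml, hb.vinj _ (by omega) _ (by omega) (by omega)⟩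
      · obtain ⟨t', rfl⟩ : ∃ t', t = t' + 3 := ⟨t - 3, by omega⟩
        simp [wl, h2]
    convert (card_le_card hsub).trans card_image_le


section counting
variable {n : ℕ}

/-- All `r`-sets. -/
def PP (n r : ℕ) : Finset (Finset (Fin n)) := powersetCard r univ

lemma card_PP (n r : ℕ) : (PP n r).card = n.choose r := by simp [PP]

lemma choose_step {n k : ℕ} (h : 2 * (k + 1) ≤ n) :
    n * n.choose k ≤ 2 * (k + 1) * n.choose (k + 1) := by
  have := Nat.choose_succ_right_eq n k
  have h2 : n ≤ 2 * (n - k) := by omega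
  calc n * n.choose k ≤ 2 * (n - k) * n.choose k := Nat.mul_le_mul_right _ h2
    _ = 2 * (n.choose k * (n - k)) := by ring
    _ = _ := by rw [← this]; ring

lemma card_superset_le (r : ℕ) (S : Finset (Fin n)) :
    ((PP n r).filter (S ⊆ ·)).card ≤ n.choose (r - S.card) := by
  calc _ ≤ (powersetCard (r - S.card) (univ : Finset (Fin n))).card := by
        apply card_le_card_of_injOn (fun e => e \ S)
        · intro e he
          obtain ⟨h1, h2⟩ := mem_filter.1 he
          have := (mem_powersetCard.1 h1).2
          rw [mem_coe, mem_powersetCard]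
          refine ⟨subset_univ _, ?_⟩
          rw [card_sdiff_of_subset h2, this]
        · intro e he e' he' hEq
          have h2 := (mem_filter.1 he).2
          have h2' := (mem_filter.1 he').2
          rw [← sdiff_union_of_subset h2, ← sdiff_union_of_subset h2']
          simp only at hEq
          rw [hEq]
    _ = _ := by simp

open Classical in
/-- The `r`-sets which are bad for `H`. -/
noncomputable def Bad (r t Δ x : ℕ) (H : Finset (Finset (Fin n))) : Finset (Finset (Fin n)) :=
  (PP n r).filter fun e => (∃ y ∈ e, Δ ≤ (H.filter (y ∈ ·)).card) ∨
    x < (nearSet (t - 1) H e).card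

lemma bad1 {r Δ m : ℕ} (hr : 3 ≤ r) (hn : 2 * r ≤ n) (hΔ : 0 < Δ)
    (h2 : 2 ^ 12 * r ^ 2 * m ≤ n * Δ) (H : Finset (Finset (Fin n)))
    (hH : ∀ A ∈ H, A.card = r) (hm : H.card ≤ m) :
    2 ^ 11 * ((PP n r).filter fun e => ∃ y ∈ e, Δ ≤ (H.filter (y ∈ ·)).card).card
      ≤ (PP n r).card := by
  set S := (univ : Finset (Fin n)).filter (fun y => Δ ≤ (H.filter (y ∈ ·)).card) with hS
  have hSum : ∑ y : Fin n, (H.filter (y ∈ ·)).card = r * H.card := by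
    have : ∀ y : Fin n, (H.filter (y ∈ ·)).card = ∑ A ∈ H, if y ∈ A then 1 else 0 := by
      intro y; rw [card_filter]
    simp_rw [this]
    rw [sum_comm]
    rw [mul_comm, ← smul_eq_mul, ← sum_const]
    apply sum_congr rfl
    intro A hA
    rw [← hH A hA]
    simp
  have hSc : S.card * Δ ≤ r * m := by
    calc S.card * Δ = ∑ _y ∈ S, Δ := by simp
      _ ≤ ∑ y ∈ S, (H.filter (y ∈ ·)).card := sum_le_sum fun y hy => (mem_filter.1 hy).2
      _ ≤ ∑ y : Fin n, (H.filter (y ∈ ·)).card := sum_le_sum_of_subset (subset_univ _)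
      _ = r * H.card := hSum
      _ ≤ r * m := Nat.mul_le_mul_left _ hm
  set B := (PP n r).filter fun e => ∃ y ∈ e, Δ ≤ (H.filter (y ∈ ·)).card with hB
  have hBc : B.card ≤ S.card * n.choose (r - 1) := by
    calc B.card ≤ (S.biUnion fun y => (PP n r).filter (({y} : Finset (Fin n)) ⊆ ·)).card := by
          apply card_le_card
          intro e he
          obtain ⟨h1, y, hy, hd⟩ := mem_filter.1 he
          exact mem_biUnion.2 ⟨y, mem_filter.2 ⟨mem_univ _, hd⟩,
            mem_filter.2 ⟨h1, singleton_subset_iff.2 hy⟩⟩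
      _ ≤ S.card * n.choose (r - 1) := by
          apply card_biUnion_le_card_mul
          intro y _
          simpa using card_superset_le r ({y} : Finset (Fin n))
  have hch := choose_step (n := n) (k := r - 1) (by omega)
  rw [show r - 1 + 1 = r by omega] at hch
  rw [card_PP]
  have hn0 : 0 < n * Δ := Nat.mul_pos (by omega) hΔ
  refine Nat.le_of_mul_le_mul_left ?_ hn0
  calc n * Δ * (2 ^ 11 * B.card) ≤ n * Δ * (2 ^ 11 * (S.card * n.choose (r - 1))) := by gcongr
    _ = 2 ^ 11 * (S.card * Δ) * (n * n.choose (r - 1)) := by ring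
    _ ≤ 2 ^ 11 * (r * m) * (2 * r * n.choose r) := by gcongr
    _ = (2 ^ 12 * r ^ 2 * m) * n.choose r := by ring
    _ ≤ n * Δ * n.choose r := by gcongr

lemma bad2 {r t Δ x : ℕ} (hr : 3 ≤ r) (hn : 2 * r ≤ n) (hx : 0 < x)
    (h3 : 2 ^ 13 * r ^ 2 * (r * Δ) ^ (t - 1) ≤ n * x) (H : Finset (Finset (Fin n)))
    (hH : ∀ A ∈ H, A.card = r) (hd : ∀ y, (H.filter (y ∈ ·)).card ≤ Δ) :
    2 ^ 11 * ((PP n r).filter fun e => x < (nearSet (t - 1) H e).card).card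
      ≤ (PP n r).card := by
  set B := (PP n r).filter fun e => x < (nearSet (t - 1) H e).card with hB
  have h1 : x * B.card ≤ ∑ e ∈ PP n r, (nearSet (t - 1) H e).card := by
    calc x * B.card = ∑ _e ∈ B, x := by simp [mul_comm]
      _ ≤ ∑ e ∈ B, (nearSet (t - 1) H e).card := sum_le_sum fun e he => (mem_filter.1 he).2.le
      _ ≤ _ := sum_le_sum_of_subset (filter_subset _ _)
  have h2 : ∑ e ∈ PP n r, (nearSet (t - 1) H e).card ≤
      n * ((r * Δ) ^ (t - 1) * n.choose (r - 2)) := by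
    have e1 : ∀ e : Finset (Fin n), (nearSet (t - 1) H e).card =
        ∑ y : Fin n, ∑ w ∈ walks H (t - 1) y,
          if ep w y ≠ y ∧ ({y, ep w y} : Finset (Fin n)) ⊆ e then 1 else 0 := by
      intro e
      rw [nearSet, card_sigma, ← sum_filter_add_sum_filter_not univ (fun y => y ∈ e)]
      have z : ∑ y ∈ univ.filter (fun y => ¬ y ∈ e), ∑ w ∈ walks H (t - 1) y,
          (if ep w y ≠ y ∧ ({y, ep w y} : Finset (Fin n)) ⊆ e then 1 else 0) = 0 := by
        apply sum_eq_zero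
        intro y hy
        apply sum_eq_zero
        intro w _
        rw [if_neg]
        intro h
        exact (mem_filter.1 hy).2 (h.2 (mem_insert_self _ _))
      rw [z, add_zero]
      have : univ.filter (fun y => y ∈ e) = e := by ext; simp
      rw [this]
      apply sum_congr rfl
      intro y hy
      rw [card_filter]
      apply sum_congr rfl
      intro w _
      congr 1
      simp only [insert_subset_iff, singleton_subset_iff, hy, true_and, eq_iff_iff]
      tauto
    simp_rw [e1]
    rw [sum_comm]
    calc _ ≤ ∑ _y : Fin n, ((r * Δ) ^ (t - 1) * n.choose (r - 2)) := by
          apply sum_le_sum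
          intro y _
          rw [sum_comm]
          calc _ ≤ ∑ w ∈ walks H (t - 1) y, n.choose (r - 2) := by
                apply sum_le_sum
                intro w _
                rw [← card_filter]
                by_cases hne : ep w y ≠ y
                · have := card_superset_le r ({y, ep w y} : Finset (Fin n))
                  rw [card_pair (Ne.symm hne)] at this
                  simpa [hne] using this
                · simp [hne]
            _ = (walks H (t - 1) y).card * n.choose (r - 2) := by simp
            _ ≤ _ := Nat.mul_le_mul_right _ (card_walks_le hH hd _ _)
      _ = _ := by simp
  have c1 := choose_step (n := n) (k := r - 1) (by omega)
  have c2 := choose_step (n := n) (k := r - 2) (by omega)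
  rw [show r - 1 + 1 = r by omega] at c1
  rw [show r - 2 + 1 = r - 1 by omega] at c2
  have c3 : n * n * n.choose (r - 2) ≤ 4 * r ^ 2 * n.choose r := by
    calc n * n * n.choose (r - 2) = n * (n * n.choose (r - 2)) := by ring
      _ ≤ n * (2 * (r - 1) * n.choose (r - 1)) := by gcongr
      _ = 2 * (r - 1) * (n * n.choose (r - 1)) := by ring
      _ ≤ 2 * r * (2 * r * n.choose r) := by gcongr; omega
      _ = _ := by ring
  rw [card_PP]
  have hn0 : 0 < n * (n * x) := Nat.mul_pos (by omega) (Nat.mul_pos (by omega) hx)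
  refine Nat.le_of_mul_le_mul_left ?_ hn0
  calc n * (n * x) * (2 ^ 11 * B.card) = 2 ^ 11 * n * n * (x * B.card) := by ring
    _ ≤ 2 ^ 11 * n * n * (n * ((r * Δ) ^ (t - 1) * n.choose (r - 2))) :=
        Nat.mul_le_mul_left _ (h1.trans h2)
    _ = 2 ^ 11 * n * (r * Δ) ^ (t - 1) * (n * n * n.choose (r - 2)) := by ring
    _ ≤ 2 ^ 11 * n * (r * Δ) ^ (t - 1) * (4 * r ^ 2 * n.choose r) := by gcongr
    _ = n * (2 ^ 13 * r ^ 2 * (r * Δ) ^ (t - 1)) * n.choose r := by ring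
    _ ≤ n * (n * x) * n.choose r := by gcongr

lemma bad_card {r t Δ x m : ℕ} (hr : 3 ≤ r) (hn : 2 * r ≤ n) (hΔ : 0 < Δ) (hx : 0 < x)
    (h2 : 2 ^ 12 * r ^ 2 * m ≤ n * Δ)
    (h3 : 2 ^ 13 * r ^ 2 * (r * Δ) ^ (t - 1) ≤ n * x) (H : Finset (Finset (Fin n)))
    (hH : ∀ A ∈ H, A.card = r) (hm : H.card ≤ m) (hd : ∀ y, (H.filter (y ∈ ·)).card ≤ Δ) :
    2 ^ 10 * (Bad r t Δ x H).card ≤ (PP n r).card := by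
  have a := bad1 hr hn hΔ h2 H hH hm
  have b := bad2 hr hn hx h3 H hH hd
  have c : (Bad r t Δ x H).card ≤
      ((PP n r).filter fun e => ∃ y ∈ e, Δ ≤ (H.filter (y ∈ ·)).card).card +
      ((PP n r).filter fun e => x < (nearSet (t - 1) H e).card).card := by
    rw [Bad, filter_or]
    convert card_union_le _ _
  omega

/-- The sample space: sequences of `M` `r`-sets. -/
def Om (n r M : ℕ) : Finset (Fin M → Finset (Fin n)) := Fintype.piFinset fun _ => PP n r

lemma card_Om (n r M : ℕ) : (Om n r M).card = (PP n r).card ^ M := by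
  simp [Om, Fintype.card_piFinset]

lemma count_sub {r M : ℕ} (S : Finset (Fin M)) (B : Finset (Finset (Fin n))) :
    ((Om n r M).filter fun ω => ∀ i ∈ S, ω i ∈ B).card ≤
      B.card ^ S.card * (PP n r).card ^ (M - S.card) := by
  calc _ ≤ (Fintype.piFinset fun i => if i ∈ S then B else PP n r).card := by
        apply card_le_card
        intro ω hω
        obtain ⟨h1, h2⟩ := mem_filter.1 hω
        rw [Om, Fintype.mem_piFinset] at h1
        rw [Fintype.mem_piFinset]
        intro i
        split_ifs with hi
        · exact h2 i hi
        · exact h1 i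
    _ = _ := by
        rw [Fintype.card_piFinset]
        have : ∀ i, (if i ∈ S then B else PP n r).card =
            if i ∈ S then B.card else (PP n r).card := by
          intro i; split_ifs <;> rfl
        simp_rw [this]
        rw [prod_ite, prod_const, prod_const]
        congr 2
        · simp
        · rw [filter_not, card_sdiff_of_subset (filter_subset _ _)]
          simp

lemma count_many {r M L : ℕ} (B : Finset (Finset (Fin n))) :
    ((Om n r M).filter fun ω => L ≤ (univ.filter fun i => ω i ∈ B).card).card ≤
      2 ^ M * (B.card ^ L * (PP n r).card ^ (M - L)) := by
  calc _ ≤ ((powersetCard L (univ : Finset (Fin M))).biUnion fun S =>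
            (Om n r M).filter fun ω => ∀ i ∈ S, ω i ∈ B).card := by
        apply card_le_card
        intro ω hω
        obtain ⟨h1, h2⟩ := mem_filter.1 hω
        obtain ⟨S, hS, hSL⟩ := exists_subset_card_eq h2
        refine mem_biUnion.2 ⟨S, mem_powersetCard.2 ⟨subset_univ _, hSL⟩, mem_filter.2 ⟨h1, ?_⟩⟩
        intro i hi
        exact (mem_filter.1 (hS hi)).2
    _ ≤ (powersetCard L (univ : Finset (Fin M))).card *
          (B.card ^ L * (PP n r).card ^ (M - L)) := by
        apply card_biUnion_le_card_mul
        intro S hS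
        have := (mem_powersetCard.1 hS).2
        have h := count_sub (r := r) S B
        rwa [this] at h
    _ ≤ _ := by
        gcongr
        rw [card_powersetCard]
        simpa using Nat.choose_le_two_pow M L

lemma count_small {E : Type*} [DecidableEq E] (P : Finset E) (m : ℕ) :
    (P.powerset.filter fun H => H.card ≤ m).card ≤ (P.card + 1) ^ m := by
  calc _ ≤ ((range (m + 1)).biUnion fun i => powersetCard i P).card := by
        apply card_le_card
        intro H hH
        obtain ⟨h1, h2⟩ := mem_filter.1 hH
        exact mem_biUnion.2 ⟨H.card, by simp; omega, mem_powersetCard.2 ⟨mem_powerset.1 h1, rfl⟩⟩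
    _ ≤ ∑ i ∈ range (m + 1), (powersetCard i P).card := card_biUnion_le
    _ ≤ ∑ i ∈ range (m + 1), P.card ^ i * 1 ^ (m - i) * (m.choose i) := by
        apply sum_le_sum
        intro i hi
        rw [card_powersetCard, one_pow, mul_one]
        calc P.card.choose i ≤ P.card ^ i := Nat.choose_le_pow _ _
          _ ≤ P.card ^ i * m.choose i :=
            Nat.le_mul_of_pos_right _ (Nat.choose_pos (by simp at hi; omega))
    _ = _ := by rw [add_pow]; simp

open Classical in
lemma count_bad3 {r t Δ x m L : ℕ} (hr : 3 ≤ r) (hn : 2 * r ≤ n) (hΔ : 0 < Δ) (hx : 0 < x)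
    (h2 : 2 ^ 12 * r ^ 2 * m ≤ n * Δ)
    (h3 : 2 ^ 13 * r ^ 2 * (r * Δ) ^ (t - 1) ≤ n * x) (h4 : 4 * (n ^ r + 1) ^ m ≤ 4 ^ L) :
    4 * ((Om n r (8 * L)).filter fun ω => ∃ H : Finset (Finset (Fin n)), (∀ A ∈ H, A.card = r) ∧
      H.card ≤ m ∧ (∀ y, (H.filter (y ∈ ·)).card ≤ Δ) ∧
      L ≤ (univ.filter fun i => ω i ∈ Bad r t Δ x H).card).card ≤ (Om n r (8 * L)).card := by
  set HH := ((PP n r).powerset.filter fun H => H.card ≤ m).filter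
    (fun H => ∀ y, (H.filter (y ∈ ·)).card ≤ Δ) with hHH
  have hHHc : HH.card ≤ (n ^ r + 1) ^ m := by
    calc HH.card ≤ _ := card_le_card (filter_subset _ _)
      _ ≤ ((PP n r).card + 1) ^ m := count_small _ _
      _ ≤ _ := by
        rw [card_PP]
        gcongr
        exact Nat.choose_le_pow _ _
  have hone : ∀ H ∈ HH, 4 ^ L * ((Om n r (8 * L)).filter fun ω =>
      L ≤ (univ.filter fun i => ω i ∈ Bad r t Δ x H).card).card ≤ (PP n r).card ^ (8 * L) := by
    intro H hH
    obtain ⟨h1, hd⟩ := mem_filter.1 hH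
    obtain ⟨h1, hm⟩ := mem_filter.1 h1
    have hu : ∀ A ∈ H, A.card = r := fun A hA =>
      (mem_powersetCard.1 (mem_powerset.1 h1 hA)).2
    have hb := bad_card hr hn hΔ hx h2 h3 H hu hm hd
    have hc := count_many (r := r) (M := 8 * L) (L := L) (Bad r t Δ x H)
    calc _ ≤ 4 ^ L * (2 ^ (8 * L) * ((Bad r t Δ x H).card ^ L *
            (PP n r).card ^ (8 * L - L))) := by gcongr
      _ = (2 ^ 10 * (Bad r t Δ x H).card) ^ L * (PP n r).card ^ (7 * L) := by
          rw [show 8 * L - L = 7 * L by omega, pow_mul, mul_pow]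
          rw [← mul_assoc, ← mul_assoc, ← mul_pow]
          norm_num
      _ ≤ (PP n r).card ^ L * (PP n r).card ^ (7 * L) := by gcongr
      _ = _ := by rw [← pow_add]; congr 1; ring
  rw [card_Om]
  set N3 := (Om n r (8 * L)).filter fun ω => ∃ H : Finset (Finset (Fin n)), (∀ A ∈ H, A.card = r) ∧
      H.card ≤ m ∧ (∀ y, (H.filter (y ∈ ·)).card ≤ Δ) ∧
      L ≤ (univ.filter fun i => ω i ∈ Bad r t Δ x H).card with hN3
  have hsub : N3 ⊆ HH.biUnion fun H => (Om n r (8 * L)).filter fun ω =>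
      L ≤ (univ.filter fun i => ω i ∈ Bad r t Δ x H).card := by
    intro ω hω
    obtain ⟨h1, H, hu, hm, hd, hL⟩ := mem_filter.1 hω
    refine mem_biUnion.2 ⟨H, ?_, mem_filter.2 ⟨h1, hL⟩⟩
    refine mem_filter.2 ⟨mem_filter.2 ⟨mem_powerset.2 ?_, hm⟩, hd⟩
    intro A hA
    exact mem_powersetCard.2 ⟨subset_univ _, hu A hA⟩
  have h5 : 4 ^ L * N3.card ≤ HH.card * (PP n r).card ^ (8 * L) := by
    calc 4 ^ L * N3.card ≤ 4 ^ L * ∑ H ∈ HH, ((Om n r (8 * L)).filter fun ω =>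
          L ≤ (univ.filter fun i => ω i ∈ Bad r t Δ x H).card).card := by
          gcongr
          exact (card_le_card hsub).trans card_biUnion_le
      _ = ∑ H ∈ HH, 4 ^ L * ((Om n r (8 * L)).filter fun ω =>
          L ≤ (univ.filter fun i => ω i ∈ Bad r t Δ x H).card).card := mul_sum _ _ _
      _ ≤ ∑ H ∈ HH, (PP n r).card ^ (8 * L) := sum_le_sum hone
      _ = _ := by simp
  have hpos : 0 < (n ^ r + 1) ^ m := by positivity
  refine Nat.le_of_mul_le_mul_left ?_ hpos
  calc (n ^ r + 1) ^ m * (4 * N3.card) = 4 * (n ^ r + 1) ^ m * N3.card := by ring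
    _ ≤ 4 ^ L * N3.card := by gcongr
    _ ≤ HH.card * (PP n r).card ^ (8 * L) := h5
    _ ≤ _ := by gcongr

end counting


section badindices
variable {n : ℕ}

lemma choose_ratio {n r v : ℕ} (hn : 2 * r ≤ n) :
    v.choose r * n ^ r ≤ (2 * v) ^ r * n.choose r := by
  have h1 : (n + 1 - r) ^ r ≤ r.factorial * n.choose r := by
    rw [← Nat.descFactorial_eq_factorial_mul_choose]
    exact Nat.pow_sub_le_descFactorial n r
  have h2 : r.factorial * v.choose r ≤ v ^ r := by
    rw [← Nat.descFactorial_eq_factorial_mul_choose]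
    exact Nat.descFactorial_le_pow v r
  calc v.choose r * n ^ r ≤ v.choose r * (2 * (n + 1 - r)) ^ r := by
        gcongr; omega
    _ = 2 ^ r * v.choose r * (n + 1 - r) ^ r := by rw [mul_pow]; ring
    _ ≤ 2 ^ r * v.choose r * (r.factorial * n.choose r) := by gcongr
    _ = 2 ^ r * (r.factorial * v.choose r) * n.choose r := by ring
    _ ≤ 2 ^ r * v ^ r * n.choose r := by gcongr
    _ = _ := by rw [mul_pow]

lemma count_union {r M v : ℕ} (hv : v ≤ n) (S : Finset (Fin M)) :
    ((Om n r M).filter fun ω => (S.biUnion ω).card ≤ v).card ≤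
      n.choose v * (v.choose r ^ S.card * (PP n r).card ^ (M - S.card)) := by
  calc _ ≤ ((powersetCard v (univ : Finset (Fin n))).biUnion fun V =>
            (Om n r M).filter fun ω => ∀ i ∈ S, ω i ∈ powersetCard r V).card := by
        apply card_le_card
        intro ω hω
        obtain ⟨h1, h2⟩ := mem_filter.1 hω
        obtain ⟨V, hV, hVc⟩ := exists_superset_card_eq h2 (by simpa using hv)
        refine mem_biUnion.2 ⟨V, mem_powersetCard.2 ⟨subset_univ _, hVc⟩, mem_filter.2 ⟨h1, ?_⟩⟩
        intro i hi
        rw [mem_powersetCard]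
        refine ⟨fun a ha => hV (mem_biUnion.2 ⟨i, hi, ha⟩), ?_⟩
        have := (Fintype.mem_piFinset.1 h1) i
        exact (mem_powersetCard.1 this).2
    _ ≤ (powersetCard v (univ : Finset (Fin n))).card *
          (v.choose r ^ S.card * (PP n r).card ^ (M - S.card)) := by
        apply card_biUnion_le_card_mul
        intro V hV
        have hc := (mem_powersetCard.1 hV).2
        have h := count_sub (r := r) S (powersetCard r V)
        rwa [card_powersetCard, hc] at h
    _ = _ := by simp

lemma count_union' {r M v k : ℕ} (hr : 3 ≤ r) (hv : v ≤ n) (hn : 2 * r ≤ n)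
    (S : Finset (Fin M)) (hk : v + k = (r - 1) * S.card + 1) :
    ((Om n r M).filter fun ω => (S.biUnion ω).card ≤ v).card * n ^ (S.card + k) ≤
      n * (2 * v) ^ (r * S.card) * (Om n r M).card := by
  set T := ((Om n r M).filter fun ω => (S.biUnion ω).card ≤ v).card with hT
  set E := S.card with hE
  have hEM : E ≤ M := by simpa using card_le_univ S
  have h0 := count_union (r := r) hv S
  rw [← hE, ← hT] at h0
  have hn0 : 0 < n ^ v := pow_pos (by omega) _
  refine Nat.le_of_mul_le_mul_left ?_ hn0
  have hrE : v + (E + k) = r * E + 1 := by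
    obtain ⟨q, rfl⟩ : ∃ q, r = q + 1 := ⟨r - 1, by omega⟩
    simp only [Nat.add_sub_cancel] at hk
    rw [add_mul]; omega
  calc n ^ v * (T * n ^ (E + k)) = T * n ^ (v + (E + k)) := by rw [pow_add]; ring
    _ = T * (n ^ r) ^ E * n := by rw [hrE, pow_succ, pow_mul]; ring
    _ ≤ (n.choose v * (v.choose r ^ E * (PP n r).card ^ (M - E))) * (n ^ r) ^ E * n := by gcongr
    _ = n.choose v * (v.choose r * n ^ r) ^ E * (PP n r).card ^ (M - E) * n := by
        rw [mul_pow]; ring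
    _ ≤ n ^ v * ((2 * v) ^ r * n.choose r) ^ E * (PP n r).card ^ (M - E) * n :=
        Nat.mul_le_mul_right _ (Nat.mul_le_mul_right _ (Nat.mul_le_mul (Nat.choose_le_pow _ _)
          (Nat.pow_le_pow_left (choose_ratio hn) _)))
    _ = n ^ v * (n * (2 * v) ^ (r * E) * ((PP n r).card ^ E * (PP n r).card ^ (M - E))) := by
        rw [card_PP, mul_pow, pow_mul]; ring
    _ = _ := by rw [card_Om, ← pow_add, Nat.add_sub_cancel' hEM]

/-- An index that lies in a dense small subfamily. -/
def BadIdx (r t : ℕ) {M : ℕ} (ω : Fin M → Finset (Fin n)) (i : Fin M) : Prop :=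
  ∃ S : Finset (Fin M), i ∈ S ∧ ∃ k, 1 ≤ k ∧ k ≤ 3 ∧ S.card ≤ k * (t - 1) ∧
    (S.biUnion ω).card + k ≤ (r - 1) * S.card + 1

/-- The constant of the deletion step. -/
def KK (r t : ℕ) : ℕ := 3 * t * (6 * r * t) ^ (3 * r * t) * (576 * t)

open Classical in
lemma sum_badidx {r t M D : ℕ} (hr : 3 ≤ r) (ht : 5 ≤ t) (hn : 3 * r * t ≤ n) (hD : 0 < D)
    (hM : M = n * D)
    (h1 : ∀ k, 1 ≤ k → k ≤ 3 → KK r t * D ^ (k * (t - 1)) ≤ D * n ^ k) :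
    64 * ∑ ω ∈ Om n r M, (univ.filter fun i => BadIdx r t ω i).card ≤ M * (Om n r M).card := by
  set J := ((Icc 1 3) ×ˢ (Icc 1 (3 * t))).filter (fun p : ℕ × ℕ => p.2 ≤ p.1 * (t - 1)) with hJ
  have hJc : J.card ≤ 9 * t := by
    calc J.card ≤ _ := card_le_card (filter_subset _ _)
      _ = 9 * t := by simp; ring
  have hn2 : 2 * r ≤ n := by nlinarith
  have hn0 : 0 < n := by omega
  -- pointwise bound
  have hpt : ∀ ω ∈ Om n r M, (univ.filter fun i => BadIdx r t ω i).card ≤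
      ∑ p ∈ J, ∑ S ∈ powersetCard p.2 (univ : Finset (Fin M)),
        if (S.biUnion ω).card ≤ (r - 1) * p.2 + 1 - p.1 then p.2 else 0 := by
    intro ω _
    calc _ ≤ (J.biUnion fun p => (powersetCard p.2 (univ : Finset (Fin M))).biUnion fun S =>
            if (S.biUnion ω).card ≤ (r - 1) * p.2 + 1 - p.1 then S else ∅).card := by
          apply card_le_card
          intro i hi
          obtain ⟨S, hiS, k, hk1, hk3, hSk, hc⟩ := (mem_filter.1 hi).2
          have hpos : 0 < S.card := card_pos.2 ⟨i, hiS⟩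
          refine mem_biUnion.2 ⟨(k, S.card), ?_, mem_biUnion.2 ⟨S, ?_, ?_⟩⟩
          · rw [hJ, mem_filter, mem_product, mem_Icc, mem_Icc]
            refine ⟨⟨⟨hk1, hk3⟩, hpos, ?_⟩, hSk⟩
            calc S.card ≤ k * (t - 1) := hSk
              _ ≤ 3 * t := Nat.mul_le_mul hk3 (by omega)
          · simp
          · rw [if_pos (by dsimp only; omega)]
            exact hiS
      _ ≤ _ := by
          refine card_biUnion_le.trans (sum_le_sum fun p _ => card_biUnion_le.trans
            (sum_le_sum fun S hS => ?_))
          have := (mem_powersetCard.1 hS).2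
          split_ifs
          · exact this.le
          · simp
  have hterm : ∀ p ∈ J, 576 * t * ∑ ω ∈ Om n r M, ∑ S ∈ powersetCard p.2 (univ : Finset (Fin M)),
        (if (S.biUnion ω).card ≤ (r - 1) * p.2 + 1 - p.1 then p.2 else 0) ≤
        M * (Om n r M).card := by
    rintro ⟨k, E⟩ hp
    rw [hJ, mem_filter, mem_product, mem_Icc, mem_Icc] at hp
    obtain ⟨⟨⟨hk1, hk3⟩, hE1, hE3⟩, hEk⟩ := hp
    dsimp only at hk1 hk3 hE1 hE3 hEk ⊢
    set v := (r - 1) * E + 1 - k with hv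
    have hvk : v + k = (r - 1) * E + 1 := by
      have : 2 * 1 ≤ (r - 1) * E := Nat.mul_le_mul (by omega) hE1
      omega
    have hv3 : v ≤ 3 * r * t := by
      have : (r - 1) * E ≤ r * (3 * t) := Nat.mul_le_mul (by omega) hE3
      have e : r * (3 * t) = 3 * r * t := by ring
      omega
    rw [sum_comm]
    have hS : ∀ S ∈ powersetCard E (univ : Finset (Fin M)),
        (∑ ω ∈ Om n r M, if (S.biUnion ω).card ≤ v then E else 0) * n ^ (E + k) ≤
          E * (n * (6 * r * t) ^ (3 * r * t) * (Om n r M).card) := by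
      intro S hS
      have hSE := (mem_powersetCard.1 hS).2
      have h := count_union' (M := M) (k := k) hr (hv3.trans hn) hn2 S (by rw [hSE]; exact hvk)
      rw [hSE] at h
      rw [← sum_filter, sum_const, smul_eq_mul]
      have hpw : (2 * v) ^ (r * E) ≤ (6 * r * t) ^ (3 * r * t) := by
        calc (2 * v) ^ (r * E) ≤ (6 * r * t) ^ (r * E) :=
              Nat.pow_le_pow_left (by
                have e : 6 * r * t = 2 * (3 * r * t) := by ring
                omega) _
          _ ≤ _ := Nat.pow_le_pow_right (by positivity) (by nlinarith)
      calc _ = E * (((Om n r M).filter fun ω => (S.biUnion ω).card ≤ v).card * n ^ (E + k)) := by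
            ring
        _ ≤ E * (n * (2 * v) ^ (r * E) * (Om n r M).card) := Nat.mul_le_mul_left _ h
        _ ≤ _ := by gcongr
    set X := ∑ S ∈ powersetCard E (univ : Finset (Fin M)),
      ∑ ω ∈ Om n r M, (if (S.biUnion ω).card ≤ v then E else 0) with hX
    have hXb : X * n ^ (E + k) ≤ M ^ E * (E * (n * (6 * r * t) ^ (3 * r * t) * (Om n r M).card)) := by
      rw [hX, sum_mul]
      calc _ ≤ ∑ _S ∈ powersetCard E (univ : Finset (Fin M)),
            E * (n * (6 * r * t) ^ (3 * r * t) * (Om n r M).card) := sum_le_sum hS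
        _ = (M.choose E) * (E * (n * (6 * r * t) ^ (3 * r * t) * (Om n r M).card)) := by simp
        _ ≤ _ := Nat.mul_le_mul_right _ (Nat.choose_le_pow _ _)
    have hh := h1 k hk1 hk3
    have hDE : D ^ E ≤ D ^ (k * (t - 1)) := Nat.pow_le_pow_right hD hEk
    have hB0 : 0 < 3 * t * (6 * r * t) ^ (3 * r * t) := by positivity
    have hpos : 0 < 3 * t * (6 * r * t) ^ (3 * r * t) * n ^ (E + k) := by positivity
    refine Nat.le_of_mul_le_mul_left ?_ hpos
    calc 3 * t * (6 * r * t) ^ (3 * r * t) * n ^ (E + k) * (576 * t * X)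
        = KK r t * (X * n ^ (E + k)) := by rw [KK]; ring
      _ ≤ KK r t * (M ^ E * (E * (n * (6 * r * t) ^ (3 * r * t) * (Om n r M).card))) := by gcongr
      _ = (KK r t * D ^ E) * n ^ E * (E * (n * (6 * r * t) ^ (3 * r * t) * (Om n r M).card)) := by
          rw [hM, mul_pow]; ring
      _ ≤ (D * n ^ k) * n ^ E * (3 * t * (n * (6 * r * t) ^ (3 * r * t) * (Om n r M).card)) :=
          Nat.mul_le_mul (Nat.mul_le_mul_right _ ((Nat.mul_le_mul_left _ hDE).trans hh))
            (Nat.mul_le_mul_right _ hE3)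
      _ = 3 * t * (6 * r * t) ^ (3 * r * t) * n ^ (E + k) * (n * D * (Om n r M).card) := by
          rw [pow_add]; ring
      _ = _ := by rw [hM]
  have ht0 : 0 < 9 * t := by omega
  refine Nat.le_of_mul_le_mul_left ?_ ht0
  calc 9 * t * (64 * ∑ ω ∈ Om n r M, (univ.filter fun i => BadIdx r t ω i).card)
      ≤ 9 * t * (64 * ∑ ω ∈ Om n r M, ∑ p ∈ J, ∑ S ∈ powersetCard p.2 (univ : Finset (Fin M)),
        if (S.biUnion ω).card ≤ (r - 1) * p.2 + 1 - p.1 then p.2 else 0) :=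
        Nat.mul_le_mul_left _ (Nat.mul_le_mul_left _ (sum_le_sum hpt))
    _ = ∑ p ∈ J, 576 * t * ∑ ω ∈ Om n r M, ∑ S ∈ powersetCard p.2 (univ : Finset (Fin M)),
        (if (S.biUnion ω).card ≤ (r - 1) * p.2 + 1 - p.1 then p.2 else 0) := by
        rw [sum_comm, ← mul_sum]; ring
    _ ≤ ∑ p ∈ J, M * (Om n r M).card := sum_le_sum hterm
    _ = J.card * (M * (Om n r M).card) := by simp
    _ ≤ _ := Nat.mul_le_mul_right _ hJc

open Classical in
lemma count_badidx {r t M D : ℕ} (hr : 3 ≤ r) (ht : 5 ≤ t) (hn : 3 * r * t ≤ n) (hD : 0 < D)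
    (hM : M = n * D)
    (h1 : ∀ k, 1 ≤ k → k ≤ 3 → KK r t * D ^ (k * (t - 1)) ≤ D * n ^ k) :
    4 * ((Om n r M).filter fun ω => M < 16 * (univ.filter fun i => BadIdx r t ω i).card).card
      ≤ (Om n r M).card := by
  have h := sum_badidx hr ht hn hD hM h1
  have hM0 : 0 < M := by
    rw [hM]; exact Nat.mul_pos (by have : 0 < 3 * r * t := by positivity
                                   omega) hD
  refine Nat.le_of_mul_le_mul_left ?_ hM0
  set A := (Om n r M).filter fun ω => M < 16 * (univ.filter fun i => BadIdx r t ω i).card with hA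
  calc M * (4 * A.card) = 4 * ∑ _ω ∈ A, M := by simp; ring
    _ ≤ 4 * ∑ ω ∈ A, 16 * (univ.filter fun i => BadIdx r t ω i).card :=
        Nat.mul_le_mul_left _ (sum_le_sum fun ω hω => (mem_filter.1 hω).2.le)
    _ ≤ 4 * ∑ ω ∈ Om n r M, 16 * (univ.filter fun i => BadIdx r t ω i).card :=
        Nat.mul_le_mul_left _ (sum_le_sum_of_subset (filter_subset _ _))
    _ = 64 * ∑ ω ∈ Om n r M, (univ.filter fun i => BadIdx r t ω i).card := by
        rw [← mul_sum]; ring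
    _ ≤ _ := h

end badindices

section finite
variable {n : ℕ}

lemma nice_of {r t M : ℕ} {ω : Fin M → Finset (Fin n)} {i : Fin M} (h : ¬ BadIdx r t ω i) :
    Nice r t (univ.image ω) (ω i) := by
  classical
  intro W hW hiW k hk1 hk3 hc
  by_contra hcon
  apply h
  have hpre : ∀ A, ∃ j, A ∈ W → ω j = A := by
    intro A
    by_cases hA : A ∈ W
    · obtain ⟨j, _, hj⟩ := mem_image.1 (hW hA)
      exact ⟨j, fun _ => hj⟩
    · exact ⟨i, fun h => absurd h hA⟩
  choose g0 hg0 using hpre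
  set g : Finset (Fin n) → Fin M := fun A => if A = ω i then i else g0 A with hg
  have hgW : ∀ A ∈ W, ω (g A) = A := by
    intro A hA
    simp only [hg]
    split_ifs with hAi
    · exact hAi.symm
    · exact hg0 A hA
  have hinj : Set.InjOn g W := by
    intro A hA B hB hAB
    rw [← hgW A hA, ← hgW B hB, hAB]
  have hcard : (W.image g).card = W.card := card_image_of_injOn hinj
  have hun : (W.image g).biUnion ω = U W := by
    rw [image_biUnion, U]
    exact biUnion_congr rfl fun A hA => hgW A hA
  refine ⟨W.image g, mem_image.2 ⟨ω i, hiW, by simp [hg]⟩, k, hk1, hk3, ?_, ?_⟩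
  · rw [hcard]; exact hc
  · rw [hcard, hun]; omega

lemma inj_of {r t M : ℕ} (hr : 3 ≤ r) (ht : 5 ≤ t) {ω : Fin M → Finset (Fin n)} {i j : Fin M}
    (hω : ∀ i, (ω i).card = r) (h : ¬ BadIdx r t ω i) (hij : ω i = ω j) : i = j := by
  by_contra hne
  apply h
  refine ⟨{i, j}, by simp, 1, le_refl _, by omega, ?_, ?_⟩
  · rw [card_pair hne]; omega
  · rw [card_pair hne]
    have : ({i, j} : Finset (Fin M)).biUnion ω = ω i := by
      simp [hij]
    rw [this, hω]
    omega

open Classical in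
theorem finite_main {r t D L Δ x m : ℕ} (hr : 3 ≤ r) (ht : 5 ≤ t) (hn : 3 * r * t ≤ n)
    (hL : 8 * L = n * D) (hΔ : 0 < Δ) (hx : 0 < x) (hD : 0 < D)
    (h1 : ∀ k, 1 ≤ k → k ≤ 3 → KK r t * D ^ (k * (t - 1)) ≤ D * n ^ k)
    (h2 : 2 ^ 12 * r ^ 2 * m ≤ n * Δ)
    (h3 : 2 ^ 13 * r ^ 2 * (r * Δ) ^ (t - 1) ≤ n * x) (h4 : 4 * (n ^ r + 1) ^ m ≤ 4 ^ L)
    (h5 : 4 * 4 ^ x * m < 8 * L) :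
    ∃ H : Finset (Finset (Fin n)), (∀ A ∈ H, A.card = r) ∧ m < H.card ∧
      ∀ s, 2 ≤ s → s ≤ t → ¬ HasBergeCycle H s := by
  have hn2 : 2 * r ≤ n := by nlinarith
  have hOm : 0 < (Om n r (8 * L)).card := by
    rw [card_Om, card_PP]
    exact pow_pos (Nat.choose_pos (by omega)) _
  have b1 := count_badidx hr ht hn hD hL h1
  have b2 := count_bad3 (t := t) hr hn2 hΔ hx h2 h3 h4
  obtain ⟨ω, hω, g1, g2⟩ : ∃ ω ∈ Om n r (8 * L),
      ¬ (8 * L < 16 * (univ.filter fun i => BadIdx r t ω i).card) ∧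
      ¬ (∃ H : Finset (Finset (Fin n)), (∀ A ∈ H, A.card = r) ∧
      H.card ≤ m ∧ (∀ y, (H.filter (y ∈ ·)).card ≤ Δ) ∧
      L ≤ (univ.filter fun i => ω i ∈ Bad r t Δ x H).card) := by
    by_contra hcon
    push Not at hcon
    have hsub : Om n r (8 * L) ⊆
        ((Om n r (8 * L)).filter fun ω =>
          8 * L < 16 * (univ.filter fun i => BadIdx r t ω i).card) ∪
        ((Om n r (8 * L)).filter fun ω => ∃ H : Finset (Finset (Fin n)), (∀ A ∈ H, A.card = r) ∧
      H.card ≤ m ∧ (∀ y, (H.filter (y ∈ ·)).card ≤ Δ) ∧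
      L ≤ (univ.filter fun i => ω i ∈ Bad r t Δ x H).card) := by
      intro ω hω
      rw [mem_union, mem_filter, mem_filter]
      by_cases hb : 8 * L < 16 * (univ.filter fun i => BadIdx r t ω i).card
      · exact Or.inl ⟨hω, hb⟩
      · exact Or.inr ⟨hω, hcon ω hω (not_lt.1 hb)⟩
    have := (card_le_card hsub).trans (card_union_le _ _)
    omega
  have hωr : ∀ i, (ω i).card = r := fun i =>
    (mem_powersetCard.1 (Fintype.mem_piFinset.1 hω i)).2
  set K := univ.image ω with hK
  have hKr : ∀ A ∈ K, A.card = r := by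
    intro A hA
    obtain ⟨i, _, rfl⟩ := mem_image.1 hA
    exact hωr i
  by_contra hcon
  push Not at hcon
  have hFm : ∀ H ∈ FF t Δ K, H.card ≤ m := by
    intro H hH
    by_contra hlt
    obtain ⟨hHK, hcyc, _⟩ := mem_FF.1 hH
    obtain ⟨s, hs2, hst, hc⟩ := hcon H (fun A hA => hKr A (hHK hA)) (not_le.1 hlt)
    obtain ⟨C, hC, hC2⟩ := (hasBC_iff H s).1 hc
    exact hcyc s hs2 hst C hC hC2
  set F := FF t Δ K with hF
  have hF0 : 0 < F.card := by
    refine card_pos.2 ⟨∅, mem_FF.2 ⟨empty_subset _, ?_, by simp⟩⟩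
    intro s hs _ C hC hcyc
    have := hcyc.card
    rw [subset_empty.1 hC] at this
    simp at this
    omega
  set I := univ.filter (fun i => ¬ BadIdx r t ω i) with hI
  have hIc : I.card + (univ.filter fun i => BadIdx r t ω i).card = 8 * L := by
    rw [hI, card_filter, card_filter, ← sum_add_distrib]
    rw [sum_congr rfl (g := fun _ => 1) (fun i _ => by by_cases h : BadIdx r t ω i <;> simp [h])]
    simp
  have hmL : 16 * m < 8 * L := by
    refine lt_of_le_of_lt ?_ h5
    have : 4 ^ 1 ≤ 4 ^ x := Nat.pow_le_pow_right (by norm_num) hx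
    nlinarith
  have hIH : ∀ H ∈ F, (I.filter fun i => ω i ∈ H).card ≤ m := by
    intro H hH
    refine le_trans ?_ (hFm H hH)
    apply card_le_card_of_injOn ω
    · intro i hi
      exact (mem_filter.1 hi).2
    · intro i hi j hj hij
      exact inj_of hr ht hωr (mem_filter.1 (mem_filter.1 hi).1).2 hij
  have hgood : ∀ H ∈ F, 6 * L ≤ (I.filter fun i => Good t Δ x H (ω i)).card := by
    intro H hH
    obtain ⟨hHK, _, hdeg⟩ := mem_FF.1 hH
    have hbad : (univ.filter fun i => ω i ∈ Bad r t Δ x H).card < L := by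
      by_contra hge
      exact g2 ⟨H, fun A hA => hKr A (hHK hA), hFm H hH, hdeg, not_lt.1 hge⟩
    have hcov : I ⊆ (I.filter fun i => Good t Δ x H (ω i)) ∪ ((I.filter fun i => ω i ∈ H) ∪
        (univ.filter fun i => ω i ∈ Bad r t Δ x H)) := by
      intro i hi
      by_cases h1 : ω i ∈ H
      · exact mem_union_right _ (mem_union_left _ (mem_filter.2 ⟨hi, h1⟩))
      by_cases h2 : ω i ∈ Bad r t Δ x H
      · exact mem_union_right _ (mem_union_right _ (mem_filter.2 ⟨mem_univ _, h2⟩))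
      refine mem_union_left _ (mem_filter.2 ⟨hi, h1, ?_, ?_⟩)
      · intro y hy
        by_contra hge
        exact h2 (mem_filter.2 ⟨Fintype.mem_piFinset.1 hω i, Or.inl ⟨y, hy, not_lt.1 hge⟩⟩)
      · by_contra hge
        exact h2 (mem_filter.2 ⟨Fintype.mem_piFinset.1 hω i, Or.inr (not_le.1 hge)⟩)
    have c1 := (card_le_card hcov).trans (card_union_le _ _)
    have c2 := card_union_le (I.filter fun i => ω i ∈ H)
        (univ.filter fun i => ω i ∈ Bad r t Δ x H)
    have c3 := hIH H hH
    omega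
  have hA : 6 * L * F.card ≤ ∑ i ∈ I, (F.filter fun H => Good t Δ x H (ω i)).card := by
    calc 6 * L * F.card = ∑ _H ∈ F, 6 * L := by simp [mul_comm]
      _ ≤ ∑ H ∈ F, (I.filter fun i => Good t Δ x H (ω i)).card := sum_le_sum hgood
      _ = _ := by
        simp_rw [card_filter]
        rw [sum_comm]
  have hB : ∑ i ∈ I, (F.filter (ω i ∈ ·)).card ≤ m * F.card := by
    calc ∑ i ∈ I, (F.filter (ω i ∈ ·)).card = ∑ H ∈ F, (I.filter fun i => ω i ∈ H).card := by
          simp_rw [card_filter]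
          rw [sum_comm]
      _ ≤ ∑ _H ∈ F, m := sum_le_sum hIH
      _ = _ := by simp [mul_comm]
  have hC : 2 * ∑ i ∈ I, (F.filter fun H => Good t Δ x H (ω i)).card ≤
      I.card * F.card + 2 * (4 ^ x * ∑ i ∈ I, (F.filter (ω i ∈ ·)).card) := by
    calc _ = ∑ i ∈ I, 2 * (F.filter fun H => Good t Δ x H (ω i)).card := mul_sum _ _ _
      _ ≤ ∑ i ∈ I, (F.card + 2 * (4 ^ x * (F.filter (ω i ∈ ·)).card)) := by
          apply sum_le_sum
          intro i hi
          exact nice_count (nice_of (mem_filter.1 hi).2) hr ht hKr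
            (mem_image.2 ⟨i, mem_univ _, rfl⟩)
      _ = _ := by
          rw [sum_add_distrib, mul_sum, mul_sum]; simp
  have hI8 : I.card ≤ 8 * L := by omega
  have key : F.card * (12 * L) ≤ F.card * (8 * L + 2 * (4 ^ x * m)) := by
    calc F.card * (12 * L) = 2 * (6 * L * F.card) := by ring
      _ ≤ I.card * F.card + 2 * (4 ^ x * ∑ i ∈ I, (F.filter (ω i ∈ ·)).card) :=
        (Nat.mul_le_mul_left _ hA).trans hC
      _ ≤ 8 * L * F.card + 2 * (4 ^ x * (m * F.card)) := by gcongr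
      _ = _ := by ring
  have := Nat.le_of_mul_le_mul_left key hF0
  have e : 4 * 4 ^ x * m = 2 * (2 * (4 ^ x * m)) := by ring
  omega

end finite

section asymptotics

lemma floor_half {u : ℝ} (hu : 2 ≤ u) : u / 2 ≤ (⌊u⌋₊ : ℝ) := by
  have := Nat.lt_floor_add_one u
  linarith

set_option maxHeartbeats 4000000 in
lemma asym_core {r t n q : ℕ} (hr : 3 ≤ r) (ht : 5 ≤ t) (hq : q = t - 1) {y δ b a z : ℝ}
    (hy : y = 1 / (q : ℝ)) (hδ : δ = 1 / (6 * (q : ℝ) ^ 2)) (hb : b = δ / 4)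
    (ha : a = b / (2 ^ 13 * (r : ℝ) ^ (q + 2))) (hz : z = (n : ℝ) ^ (δ / 4))
    (hn : 3 * r * t ≤ n) (hlogz : Real.log n ≤ z) (hlog1 : 1 ≤ Real.log n)
    (hz1 : 5 ≤ z) (hz2 : 2 * ((r : ℝ) + 3) ≤ z) (hz3 : (KK r t : ℝ) * 8 ^ (3 * q) ≤ z)
    (han : (2 : ℝ) ^ q ≤ a * n) :
    ∃ H : Finset (Finset (Fin n)), (∀ A ∈ H, A.card = r) ∧
      a ^ y / (2 ^ 13 * (r : ℝ) ^ 2) * (n : ℝ) ^ (1 + y) * Real.log n ^ y ≤ H.card ∧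
      ∀ s, 2 ≤ s → s ≤ t → ¬ HasBergeCycle H s := by
  have hq4 : 4 ≤ q := by omega
  have hq4R : (4 : ℝ) ≤ q := by exact_mod_cast hq4
  have hq0 : (0 : ℝ) < q := by linarith
  have hy0 : 0 < y := by rw [hy]; positivity
  have hyq : y * q = 1 := by rw [hy]; field_simp
  have hδ0 : 0 < δ := by rw [hδ]; positivity
  have hδq : δ * q * 6 = y := by rw [hδ, hy]; field_simp
  have hδy : δ ≤ y := by nlinarith
  have hδ1 : δ ≤ 1 := by
    have : y ≤ 1 := by rw [hy, div_le_one hq0]; linarith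
    linarith
  have hy1 : y ≤ 1 := by rw [hy, div_le_one hq0]; linarith
  have hb0 : 0 < b := by rw [hb]; positivity
  have hr0 : (0 : ℝ) < r := by exact_mod_cast (by omega : 0 < r)
  have hr1 : (1 : ℝ) ≤ r := by exact_mod_cast (by omega : 1 ≤ r)
  have ha0 : 0 < a := by rw [ha]; positivity
  have hab : a * (2 ^ 13 * (r : ℝ) ^ (q + 2)) = b := by rw [ha]; field_simp
  have ha1 : a ≤ 1 := by
    rw [ha]
    apply div_le_one_of_le₀ _ (by positivity)
    have : (1 : ℝ) ≤ (r : ℝ) ^ (q + 2) := one_le_pow₀ hr1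
    linarith
  have hn0' : 0 < n := by
    have : 0 < 3 * r * t := by positivity
    omega
  have hn0 : (0 : ℝ) < n := by exact_mod_cast hn0'
  have hn1 : (1 : ℝ) ≤ n := by exact_mod_cast hn0'
  have hlog0 : 0 < Real.log n := by linarith
  have hz0 : 0 < z := by linarith
  -- parameters
  set D' := ⌊(n : ℝ) ^ (y + δ)⌋₊ with hD'
  set Δ := ⌊(a * n * Real.log n) ^ y⌋₊ with hΔ
  set x := ⌈b * Real.log n⌉₊ with hx
  set m := n * Δ / (2 ^ 12 * r ^ 2) with hm
  set P := (n : ℝ) ^ y with hP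
  have hP0 : 0 < P := by positivity
  have hP1 : 1 ≤ P := Real.one_le_rpow hn1 hy0.le
  have hzδ : (n : ℝ) ^ δ = z ^ 4 := by
    rw [hz, ← Real.rpow_natCast, ← Real.rpow_mul hn0.le]; congr 1; push_cast; ring
  have hzδ2 : (n : ℝ) ^ (δ / 2) = z ^ 2 := by
    rw [hz, ← Real.rpow_natCast, ← Real.rpow_mul hn0.le]; congr 1; push_cast; ring
  have hPδ : (n : ℝ) ^ (y + δ) = P * z ^ 4 := by rw [Real.rpow_add hn0, hzδ]
  have hz4 : 5 ^ 4 ≤ z ^ 4 := pow_le_pow_left₀ (by norm_num) hz1 4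
  have hPz : P ≤ P * z ^ 4 := le_mul_of_one_le_right hP0.le (by linarith)
  have h2Pz : 2 ≤ P * z ^ 4 :=
    (by linarith : (2 : ℝ) ≤ z ^ 4).trans (le_mul_of_one_le_left (by positivity) hP1)
  have hD'lo : P * z ^ 4 / 2 ≤ (D' : ℝ) := by
    have := floor_half (u := (n : ℝ) ^ (y + δ)) (by rw [hPδ]; exact h2Pz)
    rw [hPδ] at this
    rw [hD', hPδ]; exact this
  have hD'hi : (D' : ℝ) ≤ P * z ^ 4 := by
    rw [hD', ← hPδ]; exact Nat.floor_le (by positivity)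
  have hw0 : 0 < a * n * Real.log n := by positivity
  have hw2 : 2 ≤ (a * n * Real.log n) ^ y := by
    have h1 : (2 : ℝ) ^ q ≤ a * n * Real.log n := by
      refine han.trans ?_
      exact le_mul_of_one_le_right (by positivity) hlog1
    calc (2 : ℝ) = ((2 : ℝ) ^ q) ^ y := by
          rw [← Real.rpow_natCast, ← Real.rpow_mul (by norm_num), mul_comm, hyq, Real.rpow_one]
      _ ≤ _ := Real.rpow_le_rpow (by positivity) h1 hy0.le
  have hΔlo : (a * n * Real.log n) ^ y / 2 ≤ (Δ : ℝ) := floor_half hw2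
  have hΔhi : (Δ : ℝ) ≤ (a * n * Real.log n) ^ y := Nat.floor_le (by positivity)
  have hΔ0 : 0 < Δ := by
    have : (0 : ℝ) < Δ := by linarith
    exact_mod_cast this
  have hΔP : (Δ : ℝ) ≤ P * z := by
    refine hΔhi.trans ?_
    calc (a * n * Real.log n) ^ y ≤ (n * z) ^ y := by
          apply Real.rpow_le_rpow hw0.le _ hy0.le
          have : a * n ≤ n := mul_le_of_le_one_left hn0.le ha1
          exact mul_le_mul this hlogz hlog0.le hn0.le
      _ = P * z ^ y := by rw [Real.mul_rpow hn0.le hz0.le]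
      _ ≤ P * z := by
          gcongr
          calc z ^ y ≤ z ^ (1 : ℝ) := Real.rpow_le_rpow_of_exponent_le (by linarith) hy1
            _ = z := Real.rpow_one z
  have hmR : (m : ℝ) ≤ n * (P * z) := by
    have h : m ≤ n * Δ := Nat.div_le_self _ _
    calc (m : ℝ) ≤ ((n * Δ : ℕ) : ℝ) := by exact_mod_cast h
      _ = n * (Δ : ℝ) := by push_cast; ring
      _ ≤ _ := by gcongr
  have h4x : (4 : ℝ) ^ x ≤ 4 * z ^ 2 := by
    have hxlt : (x : ℝ) ≤ b * Real.log n + 1 := (Nat.ceil_lt_add_one (by positivity)).le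
    have hl4 : Real.log 4 ≤ 2 := by
      have : Real.log 4 = 2 * Real.log 2 := by
        rw [show (4 : ℝ) = 2 ^ 2 by norm_num, Real.log_pow]; norm_num
      have := Real.log_two_lt_d9
      linarith
    calc (4 : ℝ) ^ x = (4 : ℝ) ^ (x : ℝ) := (Real.rpow_natCast _ _).symm
      _ ≤ (4 : ℝ) ^ (b * Real.log n + 1) :=
        Real.rpow_le_rpow_of_exponent_le (by norm_num) hxlt
      _ = (4 : ℝ) ^ (b * Real.log n) * 4 := by
        rw [Real.rpow_add (by norm_num), Real.rpow_one]
      _ ≤ z ^ 2 * 4 := by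
        gcongr
        rw [← hzδ2, Real.rpow_def_of_pos (by norm_num), Real.rpow_def_of_pos hn0]
        apply Real.exp_le_exp.2
        have : 0 < b * Real.log n := by positivity
        have e : Real.log n * (δ / 2) = 2 * (b * Real.log n) := by rw [hb]; ring
        rw [e]
        exact mul_le_mul_of_nonneg_right hl4 this.le
      _ = _ := by ring
  obtain ⟨H, hH1, hH2, hH3⟩ := finite_main (n := n) (r := r) (t := t) (D := 8 * D') (L := n * D')
    (Δ := Δ) (x := x) (m := m) hr ht hn (by ring) hΔ0
    (Nat.ceil_pos.2 (by positivity))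
    (by
      have : (0 : ℝ) < D' := lt_of_lt_of_le (by positivity) hD'lo
      have : 0 < D' := by exact_mod_cast this
      omega)
    (by
      intro k hk1 hk3
      have hk3R : (k : ℝ) ≤ 3 := by exact_mod_cast hk3
      have hDlo : P ≤ 8 * (D' : ℝ) := by linarith
      have hpw : (P * z ^ 4) ^ (k * q) ≤ (n : ℝ) ^ k * (n : ℝ) ^ (y / 2) := by
        rw [← hPδ, ← Real.rpow_natCast, ← Real.rpow_natCast, ← Real.rpow_mul hn0.le,
          ← Real.rpow_add hn0]
        apply Real.rpow_le_rpow_of_exponent_le hn1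
        push_cast
        have e : (y + δ) * (k * q) = k * (y * q) + k * (δ * q) := by ring
        rw [e, hyq]
        have h0 : 0 < δ * q := by positivity
        have h3 : (k : ℝ) * (δ * q) ≤ 3 * (δ * q) := mul_le_mul_of_nonneg_right hk3R h0.le
        linarith
      have hzy : z ≤ (n : ℝ) ^ (y / 2) := by
        rw [hz]
        apply Real.rpow_le_rpow_of_exponent_le hn1
        linarith
      have h8 : (8 : ℝ) ^ (k * q) ≤ 8 ^ (3 * q) :=
        pow_le_pow_right₀ (by norm_num) (Nat.mul_le_mul_right _ hk3)
      have hPP : (n : ℝ) ^ (y / 2) * (n : ℝ) ^ (y / 2) = P := by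
        rw [← Real.rpow_add hn0]; congr 1; ring
      rw [← hq]
      have : (KK r t : ℝ) * (8 * (D' : ℝ)) ^ (k * q) ≤ 8 * (D' : ℝ) * (n : ℝ) ^ k := by
        calc (KK r t : ℝ) * (8 * (D' : ℝ)) ^ (k * q)
            ≤ (KK r t : ℝ) * (8 * (P * z ^ 4)) ^ (k * q) := by gcongr
          _ = (KK r t : ℝ) * 8 ^ (k * q) * (P * z ^ 4) ^ (k * q) := by rw [mul_pow 8]; ring
          _ ≤ (KK r t : ℝ) * 8 ^ (3 * q) * ((n : ℝ) ^ k * (n : ℝ) ^ (y / 2)) := by gcongr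
          _ ≤ (n : ℝ) ^ (y / 2) * ((n : ℝ) ^ k * (n : ℝ) ^ (y / 2)) := by
              gcongr; exact hz3.trans hzy
          _ = P * (n : ℝ) ^ k := by rw [← hPP]; ring
          _ ≤ _ := by gcongr
      exact_mod_cast this)
    (Nat.mul_div_le _ _)
    (by
      rw [← hq]
      have hΔq : (Δ : ℝ) ^ q ≤ a * n * Real.log n := by
        calc (Δ : ℝ) ^ q ≤ ((a * n * Real.log n) ^ y) ^ q := by gcongr
          _ = _ := by rw [← Real.rpow_natCast, ← Real.rpow_mul hw0.le, hyq, Real.rpow_one]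
      have : (2 : ℝ) ^ 13 * (r : ℝ) ^ 2 * ((r : ℝ) * Δ) ^ q ≤ n * x := by
        calc (2 : ℝ) ^ 13 * (r : ℝ) ^ 2 * ((r : ℝ) * Δ) ^ q
            = (2 : ℝ) ^ 13 * (r : ℝ) ^ (q + 2) * (Δ : ℝ) ^ q := by rw [mul_pow, pow_add]; ring
          _ ≤ (2 : ℝ) ^ 13 * (r : ℝ) ^ (q + 2) * (a * n * Real.log n) := by gcongr
          _ = n * (a * (2 ^ 13 * (r : ℝ) ^ (q + 2)) * Real.log n) := by ring
          _ = n * (b * Real.log n) := by rw [hab]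
          _ ≤ n * x := by gcongr; exact Nat.le_ceil _
      exact_mod_cast this)
    (by
      have hl4 : 1 ≤ Real.log 4 := by
        have : Real.log 4 = 2 * Real.log 2 := by
          rw [show (4 : ℝ) = 2 ^ 2 by norm_num, Real.log_pow]; norm_num
        have := Real.log_two_gt_d9
        linarith
      have hn2 : (2 : ℝ) ≤ n := by
        have : 3 * 3 * 5 ≤ 3 * r * t := Nat.mul_le_mul (Nat.mul_le_mul_left _ hr) ht
        exact_mod_cast (by omega : 2 ≤ n)
      have e1 : (n : ℝ) ^ r + 1 ≤ Real.exp ((r + 1) * Real.log n) := by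
        have : Real.exp ((r + 1) * Real.log n) = (n : ℝ) ^ (r + 1) := by
          rw [← Real.rpow_natCast, Real.rpow_def_of_pos hn0]
          push_cast; congr 1; ring
        rw [this, pow_succ]
        have h1 : (1 : ℝ) ≤ (n : ℝ) ^ r := one_le_pow₀ hn1
        have h2 : (n : ℝ) ^ r * 2 ≤ (n : ℝ) ^ r * n := by gcongr
        linarith
      have key : Real.log 4 + m * ((r + 1) * Real.log n) ≤ Real.log 4 * (n * (D' : ℝ)) := by
        have k1 : m * ((r + 1) * Real.log n) ≤ n * (P * z) * (((r : ℝ) + 1) * z) := by gcongr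
        have k2 : (1 : ℝ) + n * (P * z) * (((r : ℝ) + 1) * z) ≤ n * (D' : ℝ) := by
          have u1 : (1 : ℝ) ≤ n * P := one_le_mul_of_one_le_of_one_le hn1 hP1
          have u2 : 1 + ((r : ℝ) + 1) * z ^ 2 ≤ z ^ 4 / 2 := by
            have v0 : z ≤ z ^ 2 := le_self_pow₀ (by linarith) (by norm_num)
            have v2 : 2 * ((r : ℝ) + 3) * z ^ 2 ≤ z ^ 2 * z ^ 2 := by
              gcongr
              exact hz2.trans v0
            have v3 : z ^ 2 * z ^ 2 = z ^ 4 := by ring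
            have v4 : 2 * ((r : ℝ) + 3) * z ^ 2 = 2 * (((r : ℝ) + 1) * z ^ 2) + 4 * z ^ 2 := by ring
            linarith
          calc (1 : ℝ) + n * (P * z) * (((r : ℝ) + 1) * z)
              ≤ n * P + n * P * (((r : ℝ) + 1) * z ^ 2) := by
                have e : n * (P * z) * (((r : ℝ) + 1) * z) = n * P * (((r : ℝ) + 1) * z ^ 2) := by
                  ring
                linarith
            _ = n * P * (1 + ((r : ℝ) + 1) * z ^ 2) := by ring
            _ ≤ n * P * (z ^ 4 / 2) := by gcongr
            _ = n * (P * z ^ 4 / 2) := by ring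
            _ ≤ _ := by gcongr
        have k3 : 0 ≤ m * ((r + 1) * Real.log n) := by positivity
        have k4 : m * ((r + 1) * Real.log n) ≤ Real.log 4 * (m * ((r + 1) * Real.log n)) :=
          le_mul_of_one_le_left k3 hl4
        have k5 : Real.log 4 * (1 + m * ((r + 1) * Real.log n)) ≤ Real.log 4 * (n * (D' : ℝ)) :=
          mul_le_mul_of_nonneg_left (by linarith) (by linarith)
        linarith
      have : (4 : ℝ) * ((n : ℝ) ^ r + 1) ^ m ≤ 4 ^ (n * D') := by
        calc (4 : ℝ) * ((n : ℝ) ^ r + 1) ^ m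
            ≤ Real.exp (Real.log 4) * (Real.exp ((r + 1) * Real.log n)) ^ m := by
              rw [Real.exp_log (by norm_num)]
              gcongr
          _ = Real.exp (Real.log 4 + m * ((r + 1) * Real.log n)) := by
              rw [← Real.exp_nat_mul, Real.exp_add]
          _ ≤ Real.exp (Real.log 4 * (n * (D' : ℝ))) := Real.exp_le_exp.2 key
          _ = 4 ^ (n * D') := by
              rw [← Real.rpow_natCast, Real.rpow_def_of_pos (by norm_num)]
              push_cast; rfl
      exact_mod_cast this)
    (by
      have : (4 : ℝ) * 4 ^ x * m < 8 * (n * (D' : ℝ)) := by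
        have hnP : 0 < n * P := by positivity
        calc (4 : ℝ) * 4 ^ x * m ≤ 4 * (4 * z ^ 2) * (n * (P * z)) := by gcongr
          _ = n * P * (16 * z ^ 3) := by ring
          _ < n * P * (4 * z ^ 4) := by
              apply mul_lt_mul_of_pos_left _ hnP
              have h3 : 0 < z ^ 3 := by positivity
              have h4 : z ^ 3 * 5 ≤ z ^ 3 * z := mul_le_mul_of_nonneg_left hz1 h3.le
              have h5 : z ^ 3 * z = z ^ 4 := by ring
              linarith
          _ = 8 * (n * (P * z ^ 4 / 2)) := by ring
          _ ≤ _ := by gcongr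
      exact_mod_cast this)
  refine ⟨H, hH1, ?_, hH3⟩
  have hmlo : (n : ℝ) * Δ / (2 ^ 12 * (r : ℝ) ^ 2) ≤ m + 1 := by
    rw [div_le_iff₀ (by positivity)]
    have h : n * Δ < (m + 1) * (2 ^ 12 * r ^ 2) := by
      exact Nat.lt_mul_of_div_lt (Nat.lt_succ_self _) (by positivity)
    have h' : ((n * Δ : ℕ) : ℝ) ≤ (((m + 1) * (2 ^ 12 * r ^ 2) : ℕ) : ℝ) := by exact_mod_cast h.le
    push_cast at h'
    linarith
  have hHc : (m : ℝ) + 1 ≤ H.card := by exact_mod_cast hH2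
  refine le_trans ?_ (hmlo.trans hHc)
  calc a ^ y / (2 ^ 13 * (r : ℝ) ^ 2) * (n : ℝ) ^ (1 + y) * Real.log n ^ y
      = n * ((a * n * Real.log n) ^ y / 2) / (2 ^ 12 * (r : ℝ) ^ 2) := by
        rw [Real.rpow_add hn0, Real.rpow_one, Real.mul_rpow (by positivity) hlog0.le,
          Real.mul_rpow ha0.le hn0.le]
        field_simp
    _ ≤ _ := by gcongr

open Filter in
theorem main_aux (r t : ℕ) (hr : 3 ≤ r) (ht : 5 ≤ t) :
    ∃ c : ℝ, 0 < c ∧ ∃ N : ℕ, ∀ n : ℕ, N ≤ n →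
      ∃ H : Finset (Finset (Fin n)), (∀ A ∈ H, A.card = r) ∧
        c * (n : ℝ) ^ ((t : ℝ) / ((t : ℝ) - 1)) * Real.log n ^ ((1 : ℝ) / ((t : ℝ) - 1))
          ≤ H.card ∧
        ∀ s : ℕ, 2 ≤ s → s ≤ t → ¬ HasBergeCycle H s := by
  obtain ⟨q, hq⟩ : ∃ q, q = t - 1 := ⟨_, rfl⟩
  have hqt : (t : ℝ) - 1 = q := by
    rw [hq, Nat.cast_sub (by omega)]; simp
  have hq0 : (0 : ℝ) < q := by exact_mod_cast (by omega : 0 < q)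
  set y : ℝ := 1 / (q : ℝ) with hy
  set δ : ℝ := 1 / (6 * (q : ℝ) ^ 2) with hδ
  set b : ℝ := δ / 4 with hb
  set a : ℝ := b / (2 ^ 13 * (r : ℝ) ^ (q + 2)) with ha
  have hr0 : (0 : ℝ) < r := by exact_mod_cast (by omega : 0 < r)
  have hδ0 : 0 < δ := by positivity
  have hb0 : 0 < b := by positivity
  have ha0 : 0 < a := by positivity
  have hexp : (t : ℝ) / ((t : ℝ) - 1) = 1 + y := by
    rw [hqt, hy, show (t : ℝ) = q + 1 by linarith]; field_simp
  refine ⟨a ^ y / (2 ^ 13 * (r : ℝ) ^ 2), by positivity, ?_⟩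
  have hcast : Tendsto (fun n : ℕ => (n : ℝ)) atTop atTop := tendsto_natCast_atTop_atTop
  have hzt : Tendsto (fun n : ℕ => (n : ℝ) ^ (δ / 4)) atTop atTop :=
    (tendsto_rpow_atTop (by positivity)).comp hcast
  have hlt : Tendsto (fun n : ℕ => Real.log n) atTop atTop := Real.tendsto_log_atTop.comp hcast
  have hat : Tendsto (fun n : ℕ => a * (n : ℝ)) atTop atTop := hcast.const_mul_atTop ha0
  have hlz : ∀ᶠ n : ℕ in atTop, Real.log n ≤ (n : ℝ) ^ (δ / 4) := by
    have h := (isLittleO_log_rpow_atTop (r := δ / 4) (by positivity)).bound (c := 1) one_pos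
    have h' := hcast.eventually h
    filter_upwards [h'] with n hn
    rw [one_mul, Real.norm_eq_abs, Real.norm_eq_abs] at hn
    calc Real.log n ≤ |Real.log n| := le_abs_self _
      _ ≤ _ := hn
      _ = _ := abs_of_nonneg (by positivity)
  have hev : ∀ᶠ n : ℕ in atTop, ∃ H : Finset (Finset (Fin n)), (∀ A ∈ H, A.card = r) ∧
      a ^ y / (2 ^ 13 * (r : ℝ) ^ 2) * (n : ℝ) ^ (1 + y) * Real.log n ^ y ≤ H.card ∧
      ∀ s, 2 ≤ s → s ≤ t → ¬ HasBergeCycle H s := by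
    filter_upwards [hlz, hlt.eventually_ge_atTop 1, hzt.eventually_ge_atTop 5,
      hzt.eventually_ge_atTop (2 * ((r : ℝ) + 3)),
      hzt.eventually_ge_atTop ((KK r t : ℝ) * 8 ^ (3 * q)),
      hat.eventually_ge_atTop ((2 : ℝ) ^ q), eventually_ge_atTop (3 * r * t)]
      with n e1 e2 e3 e4 e5 e6 e7
    exact asym_core hr ht hq hy hδ hb ha rfl e7 e1 e2 e3 e4 e5 e6
  obtain ⟨N, hN⟩ := eventually_atTop.1 hev
  refine ⟨N, fun n hn => ?_⟩
  rw [hexp, hqt]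
  exact hN n hn

end asymptotics

end BG

/-- Proposition 3.2: for fixed `r ≥ 3` and `t ≥ 5`,
`ex_r(n, 𝓑_t) = Ω(n^(t/(t-1)) (log n)^(1/(t-1)))`. -/
theorem stmt_10 (r t : ℕ) (hr : 3 ≤ r) (ht : 5 ≤ t) :
    ∃ c : ℝ, 0 < c ∧ ∃ N : ℕ, ∀ n : ℕ, N ≤ n →
      ∃ H : Finset (Finset (Fin n)),
        (∀ A ∈ H, A.card = r) ∧
        c * (n : ℝ) ^ ((t : ℝ) / ((t : ℝ) - 1)) *
          Real.log n ^ ((1 : ℝ) / ((t : ℝ) - 1)) ≤ H.card ∧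
        ∀ s : ℕ, 2 ≤ s → s ≤ t → ¬ HasBergeCycle H s := by
  exact BG.main_aux r t hr ht
end

section
/- Let r ≥ 3 and t ≥ 2 be integers and let H be an r-graph. Then H contains no Berge cycle of length s for any 2 ≤ s ≤ t if and only if for every integer i with 1 ≤ i ≤ t, the union of any i distinct edges of H contains at least ir - i + 1 vertices (i.e., H is 𝒢_r(ir-i, i)-free for every 1 ≤ i ≤ t). -/
theorem exists_cycle_aux {α : Type*} [DecidableEq α] (S : Finset (Finset α)) (hS : S.Nonempty) (v₀ : α)
    (h : ∀ A ∈ S, ∀ v : α, ∃ w, w ≠ v ∧ w ∈ A ∧ ∃ B ∈ S, B ≠ A ∧ w ∈ B) :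
    ∃ s, 2 ≤ s ∧ s ≤ S.card ∧ HasBergeCycle S s := by
  classical
  let T := {p : α × Finset α // p.2 ∈ S ∧ p.1 ∈ p.2 ∧ ∃ B ∈ S, B ≠ p.2 ∧ p.1 ∈ B}
  have step : ∀ p : T, ∃ q : T, q.1.1 ≠ p.1.1 ∧ q.1.2 ≠ p.1.2 ∧ p.1.1 ∈ q.1.2 := by
    rintro ⟨⟨v, A⟩, hA, hv, B, hB, hBA, hvB⟩
    obtain ⟨w, hw, hwB, C, hC, hCB, hwC⟩ := h B hB v
    exact ⟨⟨⟨w, B⟩, hB, hwB, C, hC, hCB, hwC⟩, hw, hBA, hvB⟩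
  choose f hf1 hf2 hf3 using step
  have p0 : Nonempty T := by
    obtain ⟨A, hA⟩ := hS
    obtain ⟨w, -, hwA, B, hB, hBA, hwB⟩ := h A hA v₀
    exact ⟨⟨w, A⟩, hA, hwA, B, hB, hBA, hwB⟩
  obtain ⟨p0⟩ := p0
  let g : ℕ → T := fun n => f^[n] p0
  have hg : ∀ n, g (n + 1) = f (g n) := fun n => Function.iterate_succ_apply' f n p0
  let v : ℕ → α := fun n => (g n).1.1
  let A : ℕ → Finset α := fun n => (g n).1.2
  have hAS : ∀ n, A n ∈ S := fun n => (g n).2.1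
  have hvA : ∀ n, v n ∈ A n := fun n => (g n).2.2.1
  have hvA' : ∀ n, v n ∈ A (n + 1) := fun n => by
    simp only [v, A, hg]; exact hf3 _
  have hv1 : ∀ n, v (n + 1) ≠ v n := fun n => by
    simp only [v, hg]; exact hf1 _
  have hA1 : ∀ n, A (n + 1) ≠ A n := fun n => by
    simp only [A, hg]; exact hf2 _
  clear_value v A
  have hex : ∃ d, 0 < d ∧ ∃ a, A (a + d) = A a ∨ v (a + d) = v a := by
    obtain ⟨x, y, hxy, he⟩ := Finite.exists_ne_map_eq_of_infinite
      (fun n => (⟨A n, hAS n⟩ : {X // X ∈ S}))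
    have he : A x = A y := congrArg Subtype.val he
    rcases lt_or_gt_of_ne hxy with hl | hl
    · exact ⟨y - x, by omega, x, Or.inl (by rw [Nat.add_sub_cancel' hl.le, he])⟩
    · exact ⟨x - y, by omega, y, Or.inl (by rw [Nat.add_sub_cancel' hl.le, he])⟩
  obtain ⟨d, ⟨hd0, a, ha⟩, hmin⟩ : ∃ d, (0 < d ∧ ∃ a, A (a + d) = A a ∨ v (a + d) = v a) ∧
      ∀ e < d, ¬ (0 < e ∧ ∃ a, A (a + e) = A a ∨ v (a + e) = v a) :=
    ⟨Nat.find hex, Nat.find_spec hex, fun e he => Nat.find_min hex he⟩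
  have hd2 : 2 ≤ d := by
    by_contra hlt
    obtain rfl : d = 1 := by omega
    rcases ha with ha | ha
    · exact hA1 a ha
    · exact hv1 a ha
  have key : ∀ c i j, i < d → j < d → i < j → A (c + j) ≠ A (c + i) ∧ v (c + j) ≠ v (c + i) := by
    intro c i j hi hj hij
    have := hmin (j - i) (by omega)
    have e : c + i + (j - i) = c + j := by omega
    constructor <;> intro h' <;> apply this <;> refine ⟨by omega, c + i, ?_⟩ <;> rw [e]
    · exact Or.inl h'
    · exact Or.inr h'
  have kA : ∀ c, ∀ i < d, ∀ j < d, i ≠ j → A (c + i) ≠ A (c + j) := by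
    intro c i hi j hj hij
    rcases lt_or_gt_of_ne hij with hl | hl
    · exact (key c i j hi hj hl).1.symm
    · exact (key c j i hj hi hl).1
  have kv : ∀ c, ∀ i < d, ∀ j < d, i ≠ j → v (c + i) ≠ v (c + j) := by
    intro c i hi j hj hij
    rcases lt_or_gt_of_ne hij with hl | hl
    · exact (key c i j hi hj hl).2.symm
    · exact (key c j i hj hi hl).2
  have hds : d ≤ S.card := by
    have := Finset.card_le_card_of_injOn (s := Finset.range d) (t := S) (fun i => A (0 + i))
      (fun i _ => hAS _) (by
        intro i hi j hj hij
        by_contra hne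
        exact kA 0 i (by simpa using hi) j (by simpa using hj) hne hij)
    simpa using this
  have fin : ∀ c, v (c + (d - 1)) ∈ A c → HasBergeCycle S d := by
    intro c hc
    refine ⟨fun i => v (c + i), fun i => A (c + i), kv c, kA c, fun i _ => hAS _, ?_, hvA _, hc⟩
    intro i h1 _
    refine ⟨?_, hvA _⟩
    have := hvA' (c + (i - 1))
    rwa [show c + (i - 1) + 1 = c + i by omega] at this
  refine ⟨d, hd2, hds, ?_⟩
  rcases ha with ha | ha
  · apply fin a
    have := hvA' (a + (d - 1))
    rwa [show a + (d - 1) + 1 = a + d by omega, ha] at this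
  · apply fin (a + 1)
    rw [show a + 1 + (d - 1) = a + d by omega, ha]
    exact hvA' a

theorem stmt_11 {α : Type*} [DecidableEq α] (r t : ℕ) (hr : 3 ≤ r) (ht : 2 ≤ t)
    (H : Finset (Finset α)) (hH : ∀ A ∈ H, A.card = r) :
    (∀ s : ℕ, 2 ≤ s → s ≤ t → ¬ HasBergeCycle H s) ↔
      (∀ i : ℕ, 1 ≤ i → i ≤ t → ∀ S ⊆ H, S.card = i →
        i * r - i + 1 ≤ (S.sup id).card) := by
  obtain ⟨q, rfl⟩ : ∃ q, r = q + 1 := ⟨r - 1, by omega⟩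
  have harith : ∀ i, i * (q + 1) - i = i * q := fun i => by rw [Nat.mul_succ]; omega
  simp only [harith]
  constructor
  · intro hno
    suffices hs : ∀ S : Finset (Finset α), S ⊆ H → S.Nonempty → S.card ≤ t →
        S.card * q + 1 ≤ (S.sup id).card by
      rintro i h1 h2 S hS rfl
      exact hs S hS (Finset.card_pos.mp h1) h2
    intro S
    induction S using Finset.strongInduction with
    | H S ih =>
    intro hSH hne hcard
    by_contra hlt
    push Not at hlt
    obtain ⟨v₀⟩ : Nonempty α := by
      obtain ⟨X, hX⟩ := hne
      have hXc := hH X (hSH hX)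
      obtain ⟨x, -⟩ := Finset.card_pos.mp (by omega : 0 < X.card)
      exact ⟨x⟩
    obtain ⟨s, hs2, hsS, v, A, c1, c2, c3, c4⟩ := exists_cycle_aux S hne v₀ (by
      intro A hA v
      by_contra hcon
      push Not at hcon
      have hAr := hH A (hSH hA)
      have hsup : S.sup id = A ∪ (S.erase A).sup id := by
        conv_lhs => rw [← Finset.insert_erase hA]
        rw [Finset.sup_insert]; rfl
      have hcu := Finset.card_union_add_card_inter A ((S.erase A).sup id)
      rw [← hsup] at hcu
      have hc1 := Finset.card_erase_add_one hA
      have hI : (A ∩ (S.erase A).sup id).card ≤ 1 := by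
        rw [← Finset.card_singleton v]
        apply Finset.card_le_card
        intro w hw
        rw [Finset.mem_inter, Finset.mem_sup] at hw
        obtain ⟨hwA, B, hB, hwB⟩ := hw
        rw [Finset.mem_erase] at hB
        rw [Finset.mem_singleton]
        by_contra hwv
        exact hcon w hwv hwA B hB.2 hB.1 hwB
      rw [← hc1] at hlt
      rcases (S.erase A).eq_empty_or_nonempty with he | he
      · rw [he] at hcu hlt
        simp at hcu hlt
        omega
      · have := ih _ (Finset.erase_ssubset hA) ((Finset.erase_subset _ _).trans hSH) he (by omega)
        rw [Nat.add_mul] at hlt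
        omega)
    exact hno s hs2 (hsS.trans hcard) ⟨v, A, c1, c2, fun i hi => hSH (c3 i hi), c4⟩
  · rintro hfree s hs2 hst ⟨v, A, hv, hA, hAH, hvA, h0, h0'⟩
    have hcard : ((Finset.range s).image A).card = s := by
      rw [Finset.card_image_of_injOn, Finset.card_range]
      intro i hi j hj hij
      by_contra hne
      exact hA i (by simpa using hi) j (by simpa using hj) hne hij
    have hvm : ∀ i < s, v i ∈ A i := by
      intro i hi
      rcases Nat.eq_zero_or_pos i with rfl | hp
      · exact h0
      · exact (hvA i hp hi).2
    have := hfree s (by omega) hst ((Finset.range s).image A) (by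
      intro X hX
      obtain ⟨i, hi, rfl⟩ := Finset.mem_image.mp hX
      exact hAH i (by simpa using hi)) hcard
    have hsub : ((Finset.range s).image A).sup id ⊆
        (Finset.range s).biUnion (fun i => (A i).erase (v i)) := by
      intro w hw
      rw [Finset.mem_sup] at hw
      obtain ⟨X, hX, hwX⟩ := hw
      obtain ⟨i, hi, rfl⟩ := Finset.mem_image.mp hX
      have hi : i < s := by simpa using hi
      simp only [id] at hwX
      simp only [Finset.mem_biUnion, Finset.mem_range, Finset.mem_erase]
      by_cases hwv : w = v i
      · subst hwv
        by_cases hl : i + 1 < s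
        · exact ⟨i + 1, hl, hv _ hi _ hl (by omega), (hvA (i + 1) (by omega) hl).1⟩
        · obtain rfl : i = s - 1 := by omega
          exact ⟨0, by omega, hv _ hi _ (by omega) (by omega), h0'⟩
      · exact ⟨i, hi, hwv, hwX⟩
    have h1 := Finset.card_le_card hsub
    have h2 : ((Finset.range s).biUnion (fun i => (A i).erase (v i))).card ≤ s * q := by
      have := Finset.card_biUnion_le_card_mul (Finset.range s) (fun i => (A i).erase (v i)) q (by
        intro i hi
        have hi : i < s := by simpa using hi
        rw [Finset.card_erase_of_mem (hvm i hi), hH _ (hAH i hi)]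
        omega)
      simpa using this
    omega
end
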